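/- Let F be a field of characteristic 2 and let A be a central simple F-algebra with exp A = 2 and ind A = 2^n for a positive integer n. Then A is Brauer equivalent to a tensor product of at most 2^n − 1 quaternion F-algebras, i.e. λ_2(A) ≤ 2^n − 1. -/

import Mathlib

open scoped TensorProduct

/-- A finite-dimensional central simple algebra over a field `F`. -/
def IsCSA (F A : Type) [Field F] [Ring A] [Algebra F A] : Prop :=
  Algebra.IsCentral F A ∧ IsSimpleRing A ∧ FiniteDimensional F A

/-- An `F`-algebra is split if it is isomorphic to a matrix algebra over `F`. -/
def IsSplitAlg (F A : Type) [Field F] [Ring A] [Algebra F A] : Prop :=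
  ∃ n : ℕ, 0 < n ∧ Nonempty (A ≃ₐ[F] Matrix (Fin n) (Fin n) F)

/-- Brauer equivalence of two algebras over a field `F`. -/
def IsBrauerEquiv (F A B : Type) [Field F] [Ring A] [Algebra F A] [Ring B] [Algebra F B] :
    Prop :=
  ∃ n m : ℕ, 0 < n ∧ 0 < m ∧
    Nonempty ((Matrix (Fin n) (Fin n) A) ≃ₐ[F] (Matrix (Fin m) (Fin m) B))

/-- `A` has exponent `e`: `e` is the least positive integer such that the `e`-fold tensor
power of `A` over `F` is split. -/
def HasExponent (F A : Type) [Field F] [Ring A] [Algebra F A] (e : ℕ) : Prop :=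
  0 < e ∧ IsSplitAlg F (⨂[F] _ : Fin e, A) ∧
    ∀ k : ℕ, 0 < k → IsSplitAlg F (⨂[F] _ : Fin k, A) → e ≤ k

/-- `A` has (Schur) index `d`: `A` is isomorphic to a matrix algebra over a division
algebra of dimension `d ^ 2` over `F`. -/
def HasIndex (F A : Type) [Field F] [Ring A] [Algebra F A] (d : ℕ) : Prop :=
  ∃ (D : Type) (_ : DivisionRing D) (_ : Algebra F D) (m : ℕ), 0 < m ∧
    Nonempty (A ≃ₐ[F] Matrix (Fin m) (Fin m) D) ∧ Module.finrank F D = d ^ 2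

/-- The (Schur) index of `A` is at most `d`. -/
def IndexLE (F A : Type) [Field F] [Ring A] [Algebra F A] (d : ℕ) : Prop :=
  ∃ e : ℕ, e ≤ d ∧ HasIndex F A e

/-- `A` is the cyclic (symbol) algebra `[a, b)_{p,F}` of degree `p` in characteristic `p`:
it has dimension `p ^ 2` over `F` and is generated by elements `i`, `j` subject to
`i ^ p - i = a`, `j ^ p = b`, `j * i = (i - 1) * j`. -/
def IsCyclicAlgWith (p : ℕ) (F A : Type) [Field F] [Ring A] [Algebra F A] (a b : F) : Prop :=
  b ≠ 0 ∧ Module.finrank F A = p ^ 2 ∧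
    ∃ i j : A, i ^ p - i = algebraMap F A a ∧ j ^ p = algebraMap F A b ∧
      j * i = (i - 1) * j ∧ Algebra.adjoin F {i, j} = ⊤

/-- `A` is a cyclic algebra of degree `p`, i.e. of the form `[a, b)_{p,F}`. -/
def IsCyclicPAlg (p : ℕ) (F A : Type) [Field F] [Ring A] [Algebra F A] : Prop :=
  ∃ a b : F, IsCyclicAlgWith p F A a b

/-- The `p`-symbol length of `A` is at most `m`: `A` is Brauer equivalent to a tensor
product of at most `m` cyclic `F`-algebras of degree `p`. -/
def SymbolLengthLE (p : ℕ) (F A : Type) [Field F] [Ring A] [Algebra F A] (m : ℕ) : Prop :=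
  ∃ k : ℕ, k ≤ m ∧ ∃ (D : Fin k → Type) (_ : ∀ i, Ring (D i)) (_ : ∀ i, Algebra F (D i)),
    (∀ i, IsCyclicPAlg p F (D i)) ∧ IsBrauerEquiv F A (⨂[F] i, D i)

/-- `M` is a compositum `LK` of `L` and `K` over `F`: it is generated as an `F`-algebra by
the images of `L` and `K`. -/
def IsCompositum (F L K M : Type) [Field F] [Field L] [Field K] [Field M]
    [Algebra F L] [Algebra F K] [Algebra F M] [Algebra L M] [Algebra K M]
    [IsScalarTower F L M] [IsScalarTower F K M] : Prop :=
  (IsScalarTower.toAlgHom F L M).range ⊔ (IsScalarTower.toAlgHom F K M).range = ⊤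

/-- A cyclic algebra of degree `m` over `F`: a central simple `F`-algebra of degree `m`
containing a cyclic field extension of `F` of degree `m` (as a maximal subfield). -/
def IsCyclicAlgebra (F A : Type) [Field F] [Ring A] [Algebra F A] (m : ℕ) : Prop :=
  IsCSA F A ∧ Module.finrank F A = m ^ 2 ∧
  ∃ (L : Type) (_ : Field L) (_ : Algebra F L), IsGalois F L ∧ IsCyclic (L ≃ₐ[F] L) ∧
    Module.finrank F L = m ∧ Nonempty (L →ₐ[F] A)

/-- `L/F` is a `p`-extension: there is a tower of intermediate fields from `F` to `L`
each step of which is a cyclic extension of degree `p`. -/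
def IsPExtension (p : ℕ) (F L : Type) [Field F] [Field L] [Algebra F L] : Prop :=
  ∃ (n : ℕ) (T : Fin (n + 1) → IntermediateField F L),
    T 0 = ⊥ ∧ T (Fin.last n) = ⊤ ∧
    ∀ i : Fin n, ∃ h : T i.castSucc ≤ T i.succ,
      IsGalois (T i.castSucc) (IntermediateField.extendScalars h) ∧
      IsCyclic ((IntermediateField.extendScalars h) ≃ₐ[T i.castSucc]
        (IntermediateField.extendScalars h)) ∧
      Module.finrank (T i.castSucc) (IntermediateField.extendScalars h) = p

/-- `F` is `p`-cyclic reducible: for every central simple `F`-algebra `A` of exponent `p`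
and every purely inseparable extension `K/F` with `K ^ p ⊆ F`, either `A_K` is split, or
there is a separable extension `L/F` of degree `ind (A_K) / p` such that `A_{LK}` is
Brauer equivalent to a cyclic `LK`-algebra of degree `p`. -/
def IsPCyclicReducible (p : ℕ) (F : Type) [Field F] : Prop :=
  ∀ (A : Type) [Ring A] [Algebra F A], IsCSA F A → HasExponent F A p →
  ∀ (K : Type) [Field K] [Algebra F K], IsPurelyInseparable F K →
    (∀ z : K, z ^ p ∈ (algebraMap F K).range) →
    IsSplitAlg K (K ⊗[F] A) ∨
    ∃ d : ℕ, HasIndex K (K ⊗[F] A) (p * d) ∧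
      ∃ (L : Type) (_ : Field L) (_ : Algebra F L), Algebra.IsSeparable F L ∧
        Module.finrank F L = d ∧
        ∃ (M : Type) (_ : Field M) (_ : Algebra F M) (_ : Algebra L M) (_ : Algebra K M)
          (_ : IsScalarTower F L M) (_ : IsScalarTower F K M),
          IsCompositum F L K M ∧
          ∃ (C : Type) (_ : Ring C) (_ : Algebra M C),
            IsCyclicPAlg p M C ∧ IsBrauerEquiv M (M ⊗[F] A) C

/-- `F` is `p`-reducible: for every central simple `F`-algebra `A` of exponent `p`
and every purely inseparable extension `K/F` with `K ^ p ⊆ F`, either `A_K` is split, or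
there is a separable extension `L/F` of degree `ind (A_K) / p` with `ind A_{LK} = p`. -/
def IsPReducible (p : ℕ) (F : Type) [Field F] : Prop :=
  ∀ (A : Type) [Ring A] [Algebra F A], IsCSA F A → HasExponent F A p →
  ∀ (K : Type) [Field K] [Algebra F K], IsPurelyInseparable F K →
    (∀ z : K, z ^ p ∈ (algebraMap F K).range) →
    IsSplitAlg K (K ⊗[F] A) ∨
    ∃ d : ℕ, HasIndex K (K ⊗[F] A) (p * d) ∧
      ∃ (L : Type) (_ : Field L) (_ : Algebra F L), Algebra.IsSeparable F L ∧
        Module.finrank F L = d ∧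
        ∃ (M : Type) (_ : Field M) (_ : Algebra F M) (_ : Algebra L M) (_ : Algebra K M)
          (_ : IsScalarTower F L M) (_ : IsScalarTower F K M),
          IsCompositum F L K M ∧ HasIndex M (M ⊗[F] A) p

/-- The algebra generated by left and right multiplications of a central simple algebra is the
full endomorphism algebra. -/
theorem adjoin_mulLeft_mulRight_eq_top (F A : Type*) [Field F] [Ring A] [Algebra F A]
    [Algebra.IsCentral F A] [IsSimpleRing A] [FiniteDimensional F A] :
    Algebra.adjoin F (Set.range (LinearMap.mulLeft F (A := A)) ∪
      Set.range (LinearMap.mulRight F (A := A))) = ⊤ := by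
  set M := Algebra.adjoin F (Set.range (LinearMap.mulLeft F (A := A)) ∪
      Set.range (LinearMap.mulRight F (A := A))) with hM
  have hl (a : A) : LinearMap.mulLeft F a ∈ M := Algebra.subset_adjoin (Or.inl ⟨a, rfl⟩)
  have hr (a : A) : LinearMap.mulRight F a ∈ M := Algebra.subset_adjoin (Or.inr ⟨a, rfl⟩)
  have : IsSimpleModule M A := by
    rw [isSimpleModule_iff_toSpanSingleton_surjective]
    refine ⟨inferInstance, fun m hm => ?_⟩
    let I : TwoSidedIdeal A := .mk' (Submodule.span M {m} : Set A) (zero_mem _) (add_mem · ·)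
      (fun {x} hx => by
        have h := Submodule.smul_mem _ (⟨_, hl (-1)⟩ : M) hx
        rwa [show (⟨_, hl (-1)⟩ : M) • x = -x from neg_one_mul x] at h)
      (fun {x y} hy => Submodule.smul_mem _ (⟨_, hl x⟩ : M) hy)
      (fun {x y} hx => Submodule.smul_mem _ (⟨_, hr y⟩ : M) hx)
    have h1 : (1 : A) ∈ I := IsSimpleRing.one_mem_of_ne_zero_mem I hm 
      ((TwoSidedIdeal.mem_mk' ..).2 (Submodule.mem_span_singleton_self (R := M) m))
    have h1' : (1 : A) ∈ Submodule.span M {m} := (TwoSidedIdeal.mem_mk' ..).1 h1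
    obtain ⟨r, hr1⟩ := Submodule.mem_span_singleton.1 h1'
    intro x
    refine ⟨(⟨_, hl x⟩ : M) * r, ?_⟩
    simp only [LinearMap.toSpanSingleton_apply, mul_smul, hr1]
    exact mul_one x
  refine eq_top_iff.2 fun f _ => ?_
  have hcomm (e : Module.End M A) : ∃ c : F, ∀ x, e x = c • x := by
    have hL (x : A) : e x = x * e 1 := by
      simpa [Subalgebra.smul_def] using e.map_smul (⟨_, hl x⟩ : M) 1
    have hR (x : A) : e x = e 1 * x := by
      simpa [Subalgebra.smul_def] using e.map_smul (⟨_, hr x⟩ : M) 1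
    have : e 1 ∈ Subalgebra.center F A :=
      Subalgebra.mem_center_iff.2 fun x => by rw [← hL, ← hR]
    obtain ⟨c, hc⟩ := Algebra.mem_bot.1 (Algebra.IsCentral.out this)
    exact ⟨c, fun x => by rw [hR, ← hc, Algebra.smul_def]⟩
  let f' : Module.End (Module.End M A) A :=
    { f with
      map_smul' := fun e x => by
        obtain ⟨c, hc⟩ := hcomm e
        simp [hc] }
  classical
  let b := Module.finBasis F A
  obtain ⟨r, hr⟩ := jacobson_density (R := M) (M := A) f' (Finset.univ.image b)
  have : f = r := b.ext fun i => hr _ (by simp)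
  exact this ▸ r.2

section TensorSimple

variable {F A B : Type*} [Field F] [Ring A] [Algebra F A] [Ring B] [Algebra F B]
  [Algebra.IsCentral F A] [IsSimpleRing A] [FiniteDimensional F A]

theorem rTensor_mem_twoSidedIdeal (I : TwoSidedIdeal (A ⊗[F] B)) (f : Module.End F A)
    (z : A ⊗[F] B) (hz : z ∈ I) : f.rTensor B z ∈ I := by
  have hf : f ∈ Algebra.adjoin F (Set.range (LinearMap.mulLeft F (A := A)) ∪
      Set.range (LinearMap.mulRight F (A := A))) := by
    rw [adjoin_mulLeft_mulRight_eq_top]; trivial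
  have hL (a : A) (z : A ⊗[F] B) : (LinearMap.mulLeft F a).rTensor B z = (a ⊗ₜ 1) * z := by
    induction z with
    | zero => simp
    | tmul x y => simp
    | add x y hx hy => rw [map_add, hx, hy, mul_add]
  have hR (a : A) (z : A ⊗[F] B) : (LinearMap.mulRight F a).rTensor B z = z * (a ⊗ₜ 1) := by
    induction z with
    | zero => simp
    | tmul x y => simp
    | add x y hx hy => rw [map_add, hx, hy, add_mul]
  induction hf using Algebra.adjoin_induction generalizing z with
  | mem f hf =>
    rcases hf with ⟨a, rfl⟩ | ⟨a, rfl⟩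
    · rw [hL]; exact I.mul_mem_left _ _ hz
    · rw [hR]; exact I.mul_mem_right _ _ hz
  | algebraMap c =>
    have : (algebraMap F (Module.End F A) c) = LinearMap.mulLeft F (algebraMap F A c) := by
      ext; simp [Algebra.smul_def]
    rw [this, hL]; exact I.mul_mem_left _ _ hz
  | add f g _ _ hf hg =>
    rw [LinearMap.rTensor_add]; exact I.add_mem (hf z hz) (hg z hz)
  | mul f g _ _ hf hg =>
    rw [Module.End.mul_eq_comp, LinearMap.rTensor_comp]; exact hf _ (hg z hz)

/-- The tensor product of a central simple algebra with a simple algebra is simple. -/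
instance isSimpleRing_tensorProduct [IsSimpleRing B] : IsSimpleRing (A ⊗[F] B) := by
  have : Nontrivial (A ⊗[F] B) :=
    (Algebra.TensorProduct.includeRight_injective (R := F) (A := A) (B := B)
      (FaithfulSMul.algebraMap_injective F A)).nontrivial
  refine IsSimpleRing.of_eq_bot_or_eq_top fun I => or_iff_not_imp_left.2 fun hI => ?_
  obtain ⟨z, hzI, hz0⟩ : ∃ z ∈ I, z ≠ 0 := by
    by_contra! h
    exact hI (TwoSidedIdeal.ext fun x => ⟨fun hx => (TwoSidedIdeal.mem_bot _).2 (h x hx),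
      fun hx => by rw [(TwoSidedIdeal.mem_bot _).1 hx]; exact I.zero_mem⟩)
  let b := Module.finBasis F A
  obtain ⟨i, hi⟩ : ∃ i, (b.coord i).rTensor B z ≠ 0 := by
    by_contra! h
    have hsum (z : A ⊗[F] B) :
        z = ∑ i, b i ⊗ₜ[F] TensorProduct.lid F B ((b.coord i).rTensor B z) := by
      induction z with
      | zero => simp
      | tmul x y =>
        simp only [LinearMap.rTensor_tmul, TensorProduct.lid_tmul, ← TensorProduct.smul_tmul,
          ← TensorProduct.sum_tmul, Module.Basis.coord_apply, b.sum_repr]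
      | add x y hx hy =>
        simp only [map_add, TensorProduct.tmul_add, Finset.sum_add_distrib, ← hx, ← hy]
    exact hz0 (by rw [hsum z]; simp [h])
  have key (z : A ⊗[F] B) : ((Algebra.linearMap F A).comp (b.coord i)).rTensor B z =
      1 ⊗ₜ (TensorProduct.lid F B ((b.coord i).rTensor B z)) := by
    induction z with
    | zero => simp
    | tmul x y => simp [Algebra.algebraMap_eq_smul_one, TensorProduct.smul_tmul]
    | add x y hx hy => simp only [map_add, TensorProduct.tmul_add, hx, hy]
  have h1 := rTensor_mem_twoSidedIdeal I ((Algebra.linearMap F A).comp (b.coord i)) z hzI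
  rw [key] at h1
  let J : TwoSidedIdeal B := I.comap Algebra.TensorProduct.includeRight
  have hJ : (1 : B) ∈ J := IsSimpleRing.one_mem_of_ne_zero_mem J
    (x := TensorProduct.lid F B ((b.coord i).rTensor B z)) (by simpa using hi)
    (by simpa [J, TwoSidedIdeal.mem_comap] using h1)
  rw [TwoSidedIdeal.mem_comap, map_one] at hJ
  exact (TwoSidedIdeal.one_mem_iff I).1 hJ

/-- The tensor product of central simple algebras is central. -/
instance isCentral_tensorProduct [Algebra.IsCentral F B] :
    Algebra.IsCentral F (A ⊗[F] B) := by
  refine ⟨fun z hz => ?_⟩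
  have hz' : z ∈ Subalgebra.centralizer F
      (Algebra.TensorProduct.includeLeft : A →ₐ[F] A ⊗[F] B).range :=
    Subalgebra.center_le_centralizer F _ hz
  rw [Subalgebra.centralizer_coe_range_includeLeft_eq_center_tensorProduct] at hz'
  obtain ⟨y, rfl⟩ := hz'
  obtain ⟨b, hb⟩ : ∃ b : B, Algebra.TensorProduct.map (Subalgebra.center F A).val
      (AlgHom.id F B) y = 1 ⊗ₜ b := by
    clear hz
    induction y with
    | zero => exact ⟨0, by simp⟩
    | tmul c b =>
      obtain ⟨r, hr⟩ := Algebra.mem_bot.1 (Algebra.IsCentral.out c.2)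
      refine ⟨r • b, ?_⟩
      simp [← hr, Algebra.algebraMap_eq_smul_one, TensorProduct.smul_tmul]
    | add x y hx hy =>
      obtain ⟨b, hb⟩ := hx
      obtain ⟨c, hc⟩ := hy
      exact ⟨b + c, by rw [map_add, hb, hc, TensorProduct.tmul_add]⟩
  change Algebra.TensorProduct.map (Subalgebra.center F A).val (AlgHom.id F B) y ∈ _ at hz
  change Algebra.TensorProduct.map (Subalgebra.center F A).val (AlgHom.id F B) y ∈ _
  rw [hb] at hz ⊢
  have hinj := Algebra.TensorProduct.includeRight_injective (R := F) (A := A) (B := B)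
      (FaithfulSMul.algebraMap_injective F A)
  have hbc : b ∈ Subalgebra.center F B := Subalgebra.mem_center_iff.2 fun c => hinj <| by
    simpa using Subalgebra.mem_center_iff.1 hz (1 ⊗ₜ c)
  obtain ⟨r, rfl⟩ := Algebra.mem_bot.1 (Algebra.IsCentral.out hbc)
  exact Algebra.mem_bot.2 ⟨r, by
    simp [Algebra.algebraMap_eq_smul_one, Algebra.TensorProduct.one_def]⟩

end TensorSimple

section Representations

theorem nontrivial_of_finrank_eq_sq {F A K V : Type*} [Field F] [Ring A] [Algebra F A]
    [Field K] [AddCommGroup V] [Module K V] [Nontrivial A] [FiniteDimensional F A]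
    (h : Module.finrank F A = Module.finrank K V ^ 2) : Nontrivial V := by
  have h1 : 0 < Module.finrank F A := Module.finrank_pos
  exact Module.nontrivial_of_finrank_pos (R := K) (pos_of_ne_zero fun h0 => by simp [h0, h] at h1)


variable {F A K V : Type*} [Field F] [Ring A] [Algebra F A] [Field K] [Algebra F K]
  [AddCommGroup V] [Module K V] [Module F V] [IsScalarTower F K V]

/-- The `K`-linear extension of a representation of `A` by `K`-linear endomorphisms. -/
noncomputable def liftEnd (φ : A →ₐ[F] Module.End K V) : K ⊗[F] A →ₐ[K] Module.End K V :=
  Algebra.TensorProduct.lift (Algebra.ofId K (Module.End K V)) φ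
    fun k a => by rw [Algebra.ofId_apply]; exact Algebra.commute_algebraMap_left k (φ a)

@[simp]
theorem liftEnd_tmul (φ : A →ₐ[F] Module.End K V) (k : K) (a : A) :
    liftEnd φ (k ⊗ₜ a) = k • φ a := by
  rw [liftEnd, Algebra.TensorProduct.lift_tmul, Algebra.ofId_apply, Algebra.smul_def]

variable [Algebra.IsCentral F A] [IsSimpleRing A] [FiniteDimensional F A]

theorem liftEnd_injective [Nontrivial V] (φ : A →ₐ[F] Module.End K V) :
    Function.Injective (liftEnd φ) := by
  have : IsSimpleRing (K ⊗[F] A) :=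
    IsSimpleRing.of_ringEquiv (Algebra.TensorProduct.comm F A K).toRingEquiv inferInstance
  exact (liftEnd φ).toRingHom.injective

variable [FiniteDimensional K V]

theorem finrank_le_sq_of_algHom [Nontrivial V] (φ : A →ₐ[F] Module.End K V) :
    Module.finrank F A ≤ Module.finrank K V ^ 2 := by
  have h := LinearMap.finrank_le_finrank_of_injective (f := (liftEnd φ).toLinearMap)
    (liftEnd_injective φ)
  rwa [Module.finrank_baseChange, Module.finrank_linearMap, ← sq] at h

theorem liftEnd_bijective (φ : A →ₐ[F] Module.End K V)
    (h : Module.finrank F A = Module.finrank K V ^ 2) : Function.Bijective (liftEnd φ) := by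
  have := nontrivial_of_finrank_eq_sq h
  refine ⟨liftEnd_injective φ, ?_⟩
  refine (LinearMap.injective_iff_surjective_of_finrank_eq_finrank
    (f := (liftEnd φ).toLinearMap) ?_).1 (liftEnd_injective φ)
  rw [Module.finrank_baseChange, Module.finrank_linearMap, ← sq, h]

/-- Over a splitting field, an endomorphism commuting with the algebra is a scalar. -/
theorem exists_smul_of_commute (φ : A →ₐ[F] Module.End K V)
    (h : Module.finrank F A = Module.finrank K V ^ 2) (f : Module.End K V)
    (hf : ∀ a v, f (φ a v) = φ a (f v)) : ∃ k : K, ∀ v, f v = k • v := by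
  have hc : f ∈ Subalgebra.center K (Module.End K V) := by
    refine Subalgebra.mem_center_iff.2 fun g => ?_
    obtain ⟨z, rfl⟩ := (liftEnd_bijective φ h).2 g
    induction z with
    | zero => simp
    | tmul k a => ext v; simp [hf]
    | add x y hx hy => rw [map_add, add_mul, mul_add, hx, hy]
  obtain ⟨k, hk⟩ := Algebra.mem_bot.1 (Algebra.IsCentral.out hc)
  exact ⟨k, fun v => by rw [← hk]; simp⟩

/-- Derivations of a splitting field lift to the splitting module, compatibly with the action
of the algebra. -/
theorem exists_connection (φ : A →ₐ[F] Module.End K V)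
    (h : Module.finrank F A = Module.finrank K V ^ 2) :
    ∃ u : Derivation F K K →ₗ[K] (V →ₗ[F] V),
      (∀ δ a v, u δ (φ a v) = φ a (u δ v)) ∧
      ∀ δ (k : K) v, u δ (k • v) = k • u δ v + δ k • v := by
  have := nontrivial_of_finrank_eq_sq h
  obtain ⟨w, hw⟩ := exists_ne (0 : V)
  obtain ⟨f, hf⟩ := Module.Projective.exists_dual_eq_one K hw
  let e := AlgEquiv.ofBijective (liftEnd φ) (liftEnd_bijective φ h)
  let D (δ : Derivation F K K) : K ⊗[F] A →ₗ[F] K ⊗[F] A := LinearMap.rTensor A δ.toLinearMap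
  have hDs (δ : Derivation F K K) (k : K) (z : K ⊗[F] A) :
      D δ (k • z) = k • D δ z + δ k • z := by
    induction z with
    | zero => simp
    | tmul l a => simp [D, TensorProduct.smul_tmul', TensorProduct.add_tmul, mul_comm]
    | add x y hx hy => simp only [smul_add, map_add, hx, hy]; abel
  have hDa (δ : Derivation F K K) (a : A) (z : K ⊗[F] A) :
      D δ ((1 ⊗ₜ a) * z) = (1 ⊗ₜ a) * D δ z := by
    induction z with
    | zero => simp
    | tmul l b => simp [D]
    | add x y hx hy => simp only [mul_add, map_add, hx, hy]
  have hDadd (δ δ' : Derivation F K K) (z : K ⊗[F] A) : D (δ + δ') z = D δ z + D δ' z := by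
    induction z with
    | zero => simp
    | tmul l b => simp [D]
    | add x y hx hy => simp only [map_add, hx, hy]; abel
  have hDsmul (k : K) (δ : Derivation F K K) (z : K ⊗[F] A) : D (k • δ) z = k • D δ z := by
    induction z with
    | zero => simp
    | tmul l b => simp [D, TensorProduct.smul_tmul']
    | add x y hx hy => simp only [map_add, hx, hy, smul_add]
  have hsym (δ : Derivation F K K) (k : K) (v : V) :
      e (D δ (e.symm (f.smulRight (k • v)))) w =
        k • e (D δ (e.symm (f.smulRight v))) w + δ k • v := by
    have : f.smulRight (k • v) = k • f.smulRight v := by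
      ext x; exact smul_comm _ _ _
    rw [this, map_smul, hDs, map_add, map_smul, map_smul, AlgEquiv.apply_symm_apply]
    simp [hf]
  let u : Derivation F K K →ₗ[K] (V →ₗ[F] V) :=
    { toFun δ :=
        { toFun v := e (D δ (e.symm (f.smulRight v))) w
          map_add' v v' := by
            have : f.smulRight (v + v') = f.smulRight v + f.smulRight v' := by
              ext x; simp
            simp [this]
          map_smul' c v := by
            rw [← algebraMap_smul K c v, hsym]
            simp }
      map_add' δ δ' := by ext v; simp [hDadd]
      map_smul' k δ := by ext v; simp [hDsmul] }
  refine ⟨u, fun δ a v => ?_, fun δ k v => hsym δ k v⟩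
  change e (D δ (e.symm (f.smulRight (φ a v)))) w = φ a (e (D δ (e.symm (f.smulRight v))) w)
  have h1 : e (1 ⊗ₜ a) = φ a := (liftEnd_tmul φ 1 a).trans (one_smul _ _)
  have h2 : f.smulRight (φ a v) = e (1 ⊗ₜ a) * f.smulRight v := by
    rw [h1]; ext x; simp
  rw [h2, map_mul, AlgEquiv.symm_apply_apply, hDa, map_mul, h1]
  rfl

end Representations

section ExponentOneFields

variable {F K : Type*} [Field F] [Field K] [Algebra F K]

/-- For an extension `K` of `F` with `K ^ 2 ⊆ F`, the intermediate field `L + L z`. -/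
def quadExt (hK : ∀ z : K, z ^ 2 ∈ (algebraMap F K).range) (L : IntermediateField F K) (z : K) :
    IntermediateField F K where
  carrier := {y | ∃ a ∈ L, ∃ b ∈ L, y = a + b * z}
  zero_mem' := ⟨0, L.zero_mem, 0, L.zero_mem, by simp⟩
  one_mem' := ⟨1, L.one_mem, 0, L.zero_mem, by simp⟩
  add_mem' := by
    rintro _ _ ⟨a, ha, b, hb, rfl⟩ ⟨c, hc, d, hd, rfl⟩
    exact ⟨a + c, add_mem ha hc, b + d, add_mem hb hd, by ring⟩
  mul_mem' := by
    rintro _ _ ⟨a, ha, b, hb, rfl⟩ ⟨c, hc, d, hd, rfl⟩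
    obtain ⟨e, he⟩ := hK z
    exact ⟨a * c + b * d * algebraMap F K e, add_mem (mul_mem ha hc)
      (mul_mem (mul_mem hb hd) (L.algebraMap_mem e)), a * d + b * c,
      add_mem (mul_mem ha hd) (mul_mem hb hc), by rw [he]; ring⟩
  algebraMap_mem' r := ⟨algebraMap F K r, L.algebraMap_mem r, 0, L.zero_mem, by simp⟩
  inv_mem' := by
    rintro y ⟨a, ha, b, hb, hy⟩
    obtain ⟨e, he⟩ := hK y
    refine ⟨a * algebraMap F K e⁻¹, mul_mem ha (L.algebraMap_mem _), b * algebraMap F K e⁻¹,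
      mul_mem hb (L.algebraMap_mem _), ?_⟩
    have : y⁻¹ = y * (y ^ 2)⁻¹ := by
      rcases eq_or_ne y 0 with rfl | h
      · simp
      · field_simp
    rw [this, ← he, map_inv₀, hy]
    ring

variable {hK : ∀ z : K, z ^ 2 ∈ (algebraMap F K).range} {L : IntermediateField F K} {z : K}

theorem mem_quadExt {y : K} : y ∈ quadExt hK L z ↔ ∃ a ∈ L, ∃ b ∈ L, y = a + b * z := Iff.rfl

theorem le_quadExt : L ≤ quadExt hK L z := fun y hy => ⟨y, hy, 0, L.zero_mem, by simp⟩

theorem self_mem_quadExt : z ∈ quadExt hK L z := ⟨0, L.zero_mem, 1, L.one_mem, by simp⟩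

theorem finrank_quadExt_le [FiniteDimensional F K] :
    Module.finrank F (quadExt hK L z) ≤ 2 * Module.finrank F L := by
  let f : L × L →ₗ[F] quadExt hK L z :=
    { toFun p := ⟨p.1 + p.2 * z, p.1, p.1.2, p.2, p.2.2, rfl⟩
      map_add' p q := Subtype.ext <| by simp; ring
      map_smul' c p := Subtype.ext <| by simp [smul_add] }
  have hf : Function.Surjective f := by
    rintro ⟨_, a, ha, b, hb, rfl⟩
    exact ⟨(⟨a, ha⟩, ⟨b, hb⟩), rfl⟩
  have := LinearMap.finrank_le_finrank_of_surjective hf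
  rwa [Module.finrank_prod, ← two_mul] at this

/-- If `y ∉ L`, there is an intermediate field `M ⊇ L` not containing `y` with `K = M + M y`. -/
theorem exists_maximal_notMem [FiniteDimensional F K]
    (hK : ∀ z : K, z ^ 2 ∈ (algebraMap F K).range) (L : IntermediateField F K) (y : K)
    (hy : y ∉ L) : ∃ M : IntermediateField F K, L ≤ M ∧ y ∉ M ∧
      ∀ z, ∃ a ∈ M, ∃ b ∈ M, z = a + b * y := by
  have : WellFoundedGT (IntermediateField F K) :=
    StrictMono.wellFoundedGT (f := fun M : IntermediateField F K => M.toSubalgebra.toSubmodule)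
      fun _ _ h => h
  obtain ⟨M, ⟨hLM, hyM⟩, hmax⟩ := WellFounded.has_min (wellFounded_gt (α := IntermediateField F K))
    {M | L ≤ M ∧ y ∉ M} ⟨L, le_rfl, hy⟩
  refine ⟨M, hLM, hyM, fun z => ?_⟩
  by_cases hz : z ∈ M
  · exact ⟨z, hz, 0, M.zero_mem, by simp⟩
  have hyz : y ∈ quadExt hK M z := by
    by_contra h
    exact hmax (quadExt hK M z) ⟨hLM.trans le_quadExt, h⟩
      (lt_of_le_of_ne le_quadExt fun h => hz (h ▸ self_mem_quadExt))
  obtain ⟨a, ha, b, hb, hab⟩ := hyz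
  have hb0 : b ≠ 0 := by
    rintro rfl
    exact hyM (by simpa [hab] using ha)
  exact ⟨-a * b⁻¹, mul_mem (neg_mem ha) (inv_mem hb), b⁻¹, inv_mem hb, by
    rw [hab]; field_simp; ring⟩

/-- A quadratic purely inseparable extension `K = M + M x` has an `M`-derivation with `x ↦ x`. -/
theorem exists_derivation [CharP F 2] (hK : ∀ z : K, z ^ 2 ∈ (algebraMap F K).range)
    (M : IntermediateField F K) (x : K) (hx : x ∉ M)
    (hM : ∀ z, ∃ a ∈ M, ∃ b ∈ M, z = a + b * x) :
    ∃ δ : Derivation F K K, δ x = x ∧ (∀ z, δ z = 0 ↔ z ∈ M) ∧ ∀ z, δ (δ z) = δ z := by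
  have : CharP K 2 := charP_of_injective_algebraMap (algebraMap F K).injective 2
  choose a ha b hb hab using hM
  have uniq {c d e f : K} (hc : c ∈ M) (hd : d ∈ M) (he : e ∈ M) (hf : f ∈ M)
      (h : c + d * x = e + f * x) : d = f := by
    by_contra hdf
    have hdf' : d - f ≠ 0 := sub_ne_zero.2 hdf
    refine hx ?_
    have : x = (e - c) * (d - f)⁻¹ := by
      field_simp; linear_combination h
    rw [this]
    exact mul_mem (sub_mem he hc) (inv_mem (sub_mem hd hf))
  have hb' {c d : K} (hc : c ∈ M) (hd : d ∈ M) : b (c + d * x) = d :=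
    uniq (ha _) (hb _) hc hd (hab _).symm
  let δ₀ : K →ₗ[F] K :=
    { toFun z := b z * x
      map_add' z w := by
        have : b (z + w) = b z + b w := by
          conv_lhs => rw [show z + w = (a z + a w) + (b z + b w) * x by
            conv_lhs => rw [hab z, hab w]
            ring]
          exact hb' (add_mem (ha _) (ha _)) (add_mem (hb _) (hb _))
        rw [this, add_mul]
      map_smul' r z := by
        have : b (r • z) = r • b z := by
          conv_lhs => rw [show r • z = r • a z + (r • b z) * x by
            conv_lhs => rw [hab z]
            rw [smul_add, smul_mul_assoc]]
          exact hb' (M.smul_mem (ha _)) (M.smul_mem (hb _))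
        simp [this] }
  have hδ (z : K) : δ₀ z = b z * x := rfl
  obtain ⟨e, he⟩ := hK x
  have hmul (z w : K) : b (z * w) = a z * b w + b z * a w := by
    conv_lhs => rw [show z * w = (a z * a w + b z * b w * algebraMap F K e) +
        (a z * b w + b z * a w) * x by
      conv_lhs => rw [hab z, hab w]
      rw [he]; ring]
    exact hb' (add_mem (mul_mem (ha _) (ha _)) (mul_mem (mul_mem (hb _) (hb _))
      (M.algebraMap_mem e))) (add_mem (mul_mem (ha _) (hb _)) (mul_mem (hb _) (ha _)))
  let δ : Derivation F K K := Derivation.mk' δ₀ fun z w => by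
    simp only [hδ, hmul, smul_eq_mul]
    linear_combination (-(b w * x)) * hab z - b z * x * hab w -
      b z * b w * x ^ 2 * (CharTwo.two_eq_zero (R := K))
  have hx0 : x ≠ 0 := fun h => hx (h ▸ M.zero_mem)
  have hbx {d : K} (hd : d ∈ M) : b (d * x) = d := by
    simpa using hb' M.zero_mem hd
  refine ⟨δ, ?_, fun z => ⟨fun hz => ?_, fun hz => ?_⟩, fun z => ?_⟩
  · change b x * x = x
    conv_lhs => rw [show b x = 1 by simpa using hbx M.one_mem]
    rw [one_mul]
  · have : b z = 0 := (mul_eq_zero.1 (show b z * x = 0 from hz)).resolve_right hx0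
    rw [hab z, this]; simpa using ha z
  · change b z * x = 0
    rw [show b z = 0 by simpa using hb' hz M.zero_mem, zero_mul]
  · change b (b z * x) * x = b z * x
    rw [hbx (hb z)]

/-- The degree of `K / F` with `K ^ 2 ⊆ F` is bounded in terms of the derivations. -/
theorem finrank_le_two_pow_derivation [CharP F 2] [FiniteDimensional F K]
    (hK : ∀ z : K, z ^ 2 ∈ (algebraMap F K).range) [FiniteDimensional K (Derivation F K K)] :
    Module.finrank F K ≤ 2 ^ Module.finrank K (Derivation F K K) := by
  let N (L : IntermediateField F K) : Submodule K (Derivation F K K) :=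
    { carrier := {δ | ∀ z ∈ L, δ z = 0}
      zero_mem' := by simp
      add_mem' := fun {δ δ'} h h' z hz => by simp [h z hz, h' z hz]
      smul_mem' := fun k δ h z hz => by simp [h z hz] }
  have key (m : ℕ) : ∀ L : IntermediateField F K, Module.finrank K (N L) ≤ m →
      Module.finrank F K ≤ 2 ^ m * Module.finrank F L := by
    induction m with
    | zero =>
      intro L hL
      rw [pow_zero, one_mul, ← IntermediateField.finrank_top']
      suffices L = ⊤ by rw [this]
      by_contra hne
      obtain ⟨x, -, hx⟩ := SetLike.exists_of_lt (lt_top_iff_ne_top.2 hne)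
      obtain ⟨M, hLM, hxM, hM⟩ := exists_maximal_notMem hK L x hx
      obtain ⟨δ, hδx, hδM, -⟩ := exists_derivation hK M x hxM hM
      have h0 : N L = ⊥ := Submodule.finrank_eq_zero.1 (Nat.le_zero.1 hL)
      have : δ ∈ N L := fun z hz => (hδM z).2 (hLM hz)
      rw [h0, Submodule.mem_bot] at this
      exact hxM ((hδM x).1 (by simp [this]))
    | succ m ih =>
      intro L hL
      by_cases hne : L = ⊤
      · rw [hne, IntermediateField.finrank_top']
        exact Nat.le_mul_of_pos_left _ (by positivity)
      obtain ⟨x, -, hx⟩ := SetLike.exists_of_lt (lt_top_iff_ne_top.2 hne)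
      obtain ⟨M, hLM, hxM, hM⟩ := exists_maximal_notMem hK L x hx
      obtain ⟨δ, hδx, hδM, -⟩ := exists_derivation hK M x hxM hM
      have hlt : N (quadExt hK L x) < N L := by
        refine lt_of_le_of_ne (fun δ h z hz => h z (le_quadExt hz)) fun h => ?_
        have : δ ∈ N (quadExt hK L x) := h ▸ fun z hz => (hδM z).2 (hLM hz)
        exact hxM ((hδM x).1 (this x self_mem_quadExt))
      have h1 := ih (quadExt hK L x) (by have := Submodule.finrank_lt_finrank_of_lt hlt; omega)
      calc Module.finrank F K ≤ _ := h1
        _ ≤ 2 ^ m * (2 * Module.finrank F L) := Nat.mul_le_mul_left _ finrank_quadExt_le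
        _ = _ := by ring
  have := key _ ⊥ (Submodule.finrank_le (N ⊥))
  simpa using this

end ExponentOneFields

/-- `A` is split by an extension `K / F` of degree `r` with `K ^ 2 ⊆ F`. -/
def HasExponentOneSplitting (F A : Type) [Field F] [Ring A] [Algebra F A] (r : ℕ) : Prop :=
  ∃ (K : Type) (_ : Field K) (_ : Algebra F K) (V : Type) (_ : AddCommGroup V) (_ : Module K V)
    (_ : Module F V) (_ : IsScalarTower F K V) (_ : A →ₐ[F] Module.End K V),
    FiniteDimensional F K ∧ FiniteDimensional K V ∧ (∀ z : K, z ^ 2 ∈ (algebraMap F K).range) ∧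
      Module.finrank F A = Module.finrank K V ^ 2 ∧ Module.finrank F K = r

section Descent

/-- Constants of a derivation. -/
def Derivation.constants {F K : Type*} [Field F] [Field K] [Algebra F K]
    (δ : Derivation F K K) : IntermediateField F K where
  carrier := {z | δ z = 0}
  zero_mem' := map_zero δ
  one_mem' := δ.map_one_eq_zero
  add_mem' := fun {a b} ha hb => show δ (a + b) = 0 by
    rw [map_add, show δ a = 0 from ha, show δ b = 0 from hb, add_zero]
  mul_mem' := fun {a b} ha hb => show δ (a * b) = 0 by
    rw [δ.leibniz, show δ a = 0 from ha, show δ b = 0 from hb]; simp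
  algebraMap_mem' r := δ.map_algebraMap r
  inv_mem' a ha := show δ a⁻¹ = 0 by
    rw [Derivation.leibniz_inv, show δ a = 0 from ha, smul_zero]

theorem Derivation.mem_constants {F K : Type*} [Field F] [Field K] [Algebra F K]
    {δ : Derivation F K K} {z : K} : z ∈ δ.constants ↔ δ z = 0 := Iff.rfl

variable {F A K V : Type} [Field F] [Ring A] [Algebra F A] [Field K] [Algebra F K]
  [AddCommGroup V] [Module K V] [Module F V]

/-- The horizontal vectors of a connection along `δ`. -/
def horizontal (δ : Derivation F K K) (u : V →ₗ[F] V)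
    (hu : ∀ (k : K) v, u (k • v) = k • u v + δ k • v) : Submodule δ.constants V where
  carrier := {v | u v = 0}
  zero_mem' := map_zero u
  add_mem' := fun {a b} ha hb => show u (a + b) = 0 by
    rw [map_add, show u a = 0 from ha, show u b = 0 from hb, add_zero]
  smul_mem' := fun k v hv => by
    change u ((k : K) • v) = 0
    rw [hu, show u v = 0 from hv, Derivation.mem_constants.1 k.2]; simp

theorem linearIndependent_of_horizontal {ι : Type*} (δ : Derivation F K K) (u : V →ₗ[F] V)
    (hu : ∀ (k : K) v, u (k • v) = k • u v + δ k • v) (b : ι → V) (hb : ∀ i, u (b i) = 0)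
    (hli : LinearIndependent δ.constants b) : LinearIndependent K b := by
  classical
  rw [linearIndependent_iff']
  intro t
  induction t using Finset.induction_on with
  | empty => simp
  | insert j t hj ih =>
    intro f hf
    by_cases hfj : f j = 0
    · rw [Finset.sum_insert hj, hfj, zero_smul, zero_add] at hf
      intro i hi
      rcases Finset.mem_insert.1 hi with rfl | hi
      · exact hfj
      · exact ih f hf i hi
    · exfalso
      let f' : ι → K := fun i => (f j)⁻¹ * f i
      have hf' : ∑ i ∈ insert j t, f' i • b i = 0 := by
        simp only [f', mul_smul, ← Finset.smul_sum, hf, smul_zero]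
      have h1 : f' j = 1 := inv_mul_cancel₀ hfj
      have hδ : ∑ i ∈ t, δ (f' i) • b i = 0 := by
        have := congrArg u hf'
        simp only [map_sum, hu, hb, smul_zero, zero_add, map_zero] at this
        rwa [Finset.sum_insert hj, h1, δ.map_one_eq_zero, zero_smul, zero_add] at this
      have hc (i : ι) (hi : i ∈ insert j t) : f' i ∈ δ.constants := by
        rcases Finset.mem_insert.1 hi with rfl | hi
        · rw [h1]; exact one_mem _
        · exact ih _ hδ i hi
      let g : ι → δ.constants := fun i => if h : f' i ∈ δ.constants then ⟨f' i, h⟩ else 0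
      have hg (i : ι) (hi : i ∈ insert j t) : (g i : K) = f' i := by
        simp [g, hc i hi]
      have hgs : ∑ i ∈ insert j t, g i • b i = 0 := by
        rw [← hf']
        exact Finset.sum_congr rfl fun i hi => by rw [← hg i hi]; rfl
      have := linearIndependent_iff'.1 hli _ g hgs j (Finset.mem_insert_self _ _)
      have h2 := hg j (Finset.mem_insert_self _ _)
      rw [this, h1] at h2
      exact zero_ne_one h2

theorem finrank_range_corner_le [IsScalarTower F K V] [IsSimpleRing A] [FiniteDimensional F A]
    [FiniteDimensional K V] {D : Type} [DivisionRing D] [Algebra F D] {m d : ℕ} [NeZero m]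
    (ε : A ≃ₐ[F] Matrix (Fin m) (Fin m) D) (hd : Module.finrank F D = d ^ 2)
    (φ : A →ₐ[F] Module.End K V) (h : Module.finrank F A = Module.finrank K V ^ 2) :
    Module.finrank K (LinearMap.range (φ (ε.symm (Matrix.single 0 0 1)))) ≤ d ∧
      LinearMap.range (φ (ε.symm (Matrix.single 0 0 1))) ≠ ⊥ := by
  have := nontrivial_of_finrank_eq_sq h
  set W := LinearMap.range (φ (ε.symm (Matrix.single 0 0 1))) with hW
  let E (i j : Fin m) : Module.End K V := φ (ε.symm (Matrix.single i j 1))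
  have hE (i j k : Fin m) : E i j * E j k = E i k := by
    simp [E, ← map_mul]
  have hE' (i j k l : Fin m) (hjk : j ≠ k) : E i j * E k l = 0 := by
    simp [E, ← map_mul, hjk]
  constructor
  · have hV : Module.finrank K V = m * d := by
      rw [ε.toLinearEquiv.finrank_eq, Module.finrank_matrix, hd] at h
      refine (Nat.pow_left_injective (two_ne_zero)) ?_
      change Module.finrank K V ^ 2 = (m * d) ^ 2
      rw [← h]; simp; ring
    let f : (Fin m → W) →ₗ[K] V :=
      ∑ i, (E i 0).comp (W.subtype.comp (LinearMap.proj i))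
    have hf : Function.Injective f := by
      rw [injective_iff_map_eq_zero]
      intro w hw
      ext j
      have h1 : E 0 j (f w) = w j := by
        obtain ⟨x, hx⟩ := (w j).2
        simp only [f, LinearMap.sum_apply, LinearMap.comp_apply, map_sum]
        rw [Finset.sum_eq_single j]
        · rw [← Module.End.mul_apply, hE]
          change E 0 0 (w j) = w j
          rw [← hx]
          change (E 0 0 * E 0 0) x = E 0 0 x
          rw [hE]
        · intro i _ hij
          rw [← Module.End.mul_apply, hE' _ _ _ _ hij.symm]; rfl
        · simp
      rw [← h1, hw, map_zero]; rfl
    have := LinearMap.finrank_le_finrank_of_injective hf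
    rw [Module.finrank_pi_fintype, hV] at this
    simp only [Finset.sum_const, Finset.card_univ, Fintype.card_fin, smul_eq_mul] at this
    exact Nat.le_of_mul_le_mul_left this (Nat.pos_of_neZero m)
  · intro hbot
    have h0 : φ (ε.symm (Matrix.single 0 0 1)) = 0 := LinearMap.range_eq_bot.1 hbot
    have h1 : ε.symm (Matrix.single 0 0 (1 : D)) = 0 :=
      φ.toRingHom.injective (by simpa using h0)
    have h2 : Matrix.single (0 : Fin m) (0 : Fin m) (1 : D) = 0 := by simpa using h1
    have := congrFun (congrFun h2 0) 0
    simp at this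

variable [IsScalarTower F K V] [Algebra.IsCentral F A] [IsSimpleRing A] [FiniteDimensional F A]
  [FiniteDimensional F K] [FiniteDimensional K V]

/-- A nonzero horizontal vector yields a smaller splitting field. -/
theorem exists_smaller_splitting (hK : ∀ z : K, z ^ 2 ∈ (algebraMap F K).range)
    (φ : A →ₐ[F] Module.End K V) (h : Module.finrank F A = Module.finrank K V ^ 2)
    (δ : Derivation F K K) (hδ : δ ≠ 0) (u : V →ₗ[F] V)
    (hu : ∀ (k : K) v, u (k • v) = k • u v + δ k • v)
    (hua : ∀ a v, u (φ a v) = φ a (u v)) (s : V) (hs : s ≠ 0) (hus : u s = 0) :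
    ∃ r < Module.finrank F K, HasExponentOneSplitting F A r := by
  have : FiniteDimensional F V := FiniteDimensional.trans F K V
  have : IsScalarTower F δ.constants V :=
    ⟨fun a k v => by
      change ((a • k : δ.constants) : K) • v = a • ((k : K) • v)
      rw [IntermediateField.coe_smul, smul_assoc]⟩
  let S := horizontal δ u hu
  have hfinV : FiniteDimensional δ.constants V := FiniteDimensional.right F δ.constants V
  have hfin : FiniteDimensional δ.constants S := inferInstance
  have : Nontrivial S := ⟨⟨⟨s, hus⟩, 0, fun h => hs (congrArg Subtype.val h)⟩⟩
  let φ₀ : A →ₐ[F] Module.End δ.constants S :=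
    { toFun a :=
        { toFun v := ⟨φ a v, by
            change u _ = 0
            rw [hua, show u v = 0 from v.2, map_zero]⟩
          map_add' v w := Subtype.ext (map_add (φ a) _ _)
          map_smul' k v := Subtype.ext ((φ a).map_smul (k : K) (v : V)) }
      map_one' := by ext; simp
      map_mul' a b := by ext; simp
      map_zero' := by ext; simp
      map_add' a b := by ext; simp
      commutes' r := by ext v; simp [Module.algebraMap_end_apply] }
  have hle : Module.finrank δ.constants S ≤ Module.finrank K V := by
    let b := Module.finBasis δ.constants S
    have hli := linearIndependent_of_horizontal δ u hu (fun i => (b i : V)) (fun i => (b i).2)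
      (b.linearIndependent.map' S.subtype (Submodule.ker_subtype S))
    simpa using hli.fintype_card_le_finrank
  refine ⟨Module.finrank F δ.constants, ?_, δ.constants, inferInstance, inferInstance, S,
    inferInstance, inferInstance, inferInstance, inferInstance, φ₀, inferInstance, hfin,
    fun z => ?_, ?_, rfl⟩
  · refine Submodule.finrank_lt (s := δ.constants.toSubalgebra.toSubmodule) fun htop => hδ ?_
    ext z
    exact (htop ▸ Submodule.mem_top : z ∈ δ.constants.toSubalgebra.toSubmodule)
  · obtain ⟨c, hc⟩ := hK z
    exact ⟨c, Subtype.ext hc⟩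
  · refine le_antisymm (finrank_le_sq_of_algHom φ₀) ?_
    rw [h]
    exact Nat.pow_le_pow_left hle 2

end Descent

/-- An algebra of index `d` split by an extension of exponent one is split by such an extension
of degree at most `2 ^ (d - 1)`. -/
theorem exists_bounded_splitting {F A : Type} [Field F] [CharP F 2] [Ring A] [Algebra F A]
    [Algebra.IsCentral F A] [IsSimpleRing A] [FiniteDimensional F A]
    {D : Type} [DivisionRing D] [Algebra F D] {m d : ℕ} [NeZero m]
    (ε : A ≃ₐ[F] Matrix (Fin m) (Fin m) D) (hd : Module.finrank F D = d ^ 2)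
    (hA : ∃ r, HasExponentOneSplitting F A r) :
    ∃ r ≤ 2 ^ (d - 1), HasExponentOneSplitting F A r := by
  classical
  refine ⟨Nat.find hA, ?_, Nat.find_spec hA⟩
  obtain ⟨K, _, _, V, _, _, _, _, φ, _, _, hK, h, hr⟩ := Nat.find_spec hA
  obtain ⟨u, hua, hu⟩ := exists_connection φ h
  obtain ⟨hWd, hW0⟩ := finrank_range_corner_le ε hd φ h
  set e := ε.symm (Matrix.single 0 0 1) with he
  set W := LinearMap.range (φ e)
  obtain ⟨s, hsW, hs⟩ := Submodule.exists_mem_ne_zero_of_ne_bot hW0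
  have hmem (δ : Derivation F K K) : u δ s ∈ W := by
    obtain ⟨x, rfl⟩ := hsW
    exact ⟨u δ x, (hua δ e x).symm⟩
  let f : (Derivation F K K × K) →ₗ[K] W :=
    { toFun p := ⟨u p.1 s - p.2 • s, sub_mem (hmem _) (W.smul_mem _ hsW)⟩
      map_add' p q := Subtype.ext <| by
        simp only [Prod.fst_add, Prod.snd_add, map_add, LinearMap.add_apply, add_smul,
          Submodule.coe_add]
        abel
      map_smul' k p := Subtype.ext <| by simp [smul_sub, mul_smul] }
  have hf : Function.Injective f := by
    rw [injective_iff_map_eq_zero]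
    rintro ⟨δ, k⟩ hp
    have hp' : u δ s - k • s = 0 := congrArg Subtype.val hp
    have hδ : δ = 0 := by
      by_contra hδ
      obtain ⟨r, hlt, hsp⟩ := exists_smaller_splitting hK φ h δ hδ
        (u δ - k • LinearMap.id) (fun l v => by simp [hu, smul_sub, smul_comm k l v]; abel)
        (fun a v => by simp [hua]) s hs (by simpa using hp')
      rw [hr] at hlt
      exact Nat.find_min hA hlt hsp
    subst hδ
    simp only [map_zero, LinearMap.zero_apply, zero_sub, neg_eq_zero, smul_eq_zero, hs,
      or_false] at hp'
    rw [hp']; rfl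
  have : FiniteDimensional K (Derivation F K K × K) := FiniteDimensional.of_injective f hf
  have : FiniteDimensional K (Derivation F K K) :=
    FiniteDimensional.of_injective (LinearMap.inl K (Derivation F K K) K) LinearMap.inl_injective
  have h1 := LinearMap.finrank_le_finrank_of_injective hf
  rw [Module.finrank_prod, Module.finrank_self] at h1
  rw [← hr]
  exact (finrank_le_two_pow_derivation hK).trans (Nat.pow_le_pow_right two_pos (by omega))

open scoped Quaternion

section Brauer

variable {F : Type} [Field F]

theorem mulLeftRight_bijective (A : Type*) [Ring A] [Algebra F A]
    [Algebra.IsCentral F A] [IsSimpleRing A] [FiniteDimensional F A] :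
    Function.Bijective (AlgHom.mulLeftRight F A) := by
  have hinj : Function.Injective (AlgHom.mulLeftRight F A) :=
    (AlgHom.mulLeftRight F A).toRingHom.injective
  have hfin : FiniteDimensional F Aᵐᵒᵖ := Module.Finite.equiv (MulOpposite.opLinearEquiv F)
  have hr : Module.finrank F Aᵐᵒᵖ = Module.finrank F A :=
    (MulOpposite.opLinearEquiv F).finrank_eq.symm
  exact ⟨hinj, (LinearMap.injective_iff_surjective_of_finrank_eq_finrank
    (f := (AlgHom.mulLeftRight F A).toLinearMap) (by
      rw [Module.finrank_tensorProduct, Module.finrank_linearMap, hr])).1 hinj⟩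

theorem nonempty_tensor_self_algEquiv_matrix (Q : Type*) [Ring Q] [Algebra F Q]
    [Algebra.IsCentral F Q] [IsSimpleRing Q] [FiniteDimensional F Q] (e : Q ≃ₐ[F] Qᵐᵒᵖ) :
    Nonempty (Q ⊗[F] Q ≃ₐ[F] Matrix (Fin (Module.finrank F Q)) (Fin (Module.finrank F Q)) F) :=
  ⟨(Algebra.TensorProduct.congr (AlgEquiv.refl : Q ≃ₐ[F] Q) e).trans
    ((AlgEquiv.ofBijective (AlgHom.mulLeftRight F Q) (mulLeftRight_bijective Q)).trans
      (algEquivMatrix (Module.finBasis F Q)))⟩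

/-- Matrix algebras commute with tensor products. -/
noncomputable def tensorMatrixAlgEquiv (B C n : Type*) [Ring B] [Algebra F B] [Ring C]
    [Algebra F C] [Fintype n] [DecidableEq n] :
    B ⊗[F] Matrix n n C ≃ₐ[F] Matrix n n (B ⊗[F] C) :=
  (Algebra.TensorProduct.congr AlgEquiv.refl (matrixEquivTensor n F C)).trans
    ((Algebra.TensorProduct.assoc F F F B C (Matrix n n F)).symm.trans
      (matrixEquivTensor n F (B ⊗[F] C)).symm)

theorem IsBrauerEquiv.of_tensor_left {A Q E : Type} [Ring A] [Algebra F A] [Ring Q] [Algebra F Q]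
    [Ring E] [Algebra F E] [Algebra.IsCentral F Q] [IsSimpleRing Q] [FiniteDimensional F Q]
    (e : Q ≃ₐ[F] Qᵐᵒᵖ) (h : IsBrauerEquiv F (A ⊗[F] Q) E) : IsBrauerEquiv F A (Q ⊗[F] E) := by
  obtain ⟨n, m, hn, hm, ⟨f⟩⟩ := h
  obtain ⟨g⟩ := nonempty_tensor_self_algEquiv_matrix Q e
  have hq : 0 < Module.finrank F Q := Module.finrank_pos
  refine ⟨n * Module.finrank F Q, m, by positivity, hm, ⟨?_⟩⟩
  let e₁ : A ⊗[F] (Q ⊗[F] Q) ≃ₐ[F] Matrix (Fin (Module.finrank F Q)) (Fin (Module.finrank F Q)) A :=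
    (Algebra.TensorProduct.congr AlgEquiv.refl g).trans (matrixEquivTensor _ F A).symm
  let e₂ : Q ⊗[F] (A ⊗[F] Q) ≃ₐ[F] A ⊗[F] (Q ⊗[F] Q) :=
    (Algebra.TensorProduct.comm F Q (A ⊗[F] Q)).trans (Algebra.TensorProduct.assoc F F F A Q Q)
  exact (Matrix.reindexAlgEquiv F A finProdFinEquiv.symm).trans <|
    (Matrix.compAlgEquiv (Fin n) (Fin (Module.finrank F Q)) A F).symm.trans <|
    (e₂.trans e₁).symm.mapMatrix.trans <|
    (tensorMatrixAlgEquiv Q (A ⊗[F] Q) (Fin n)).symm.trans <|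
    (Algebra.TensorProduct.congr AlgEquiv.refl f).trans <|
    tensorMatrixAlgEquiv Q E (Fin m)

theorem IsBrauerEquiv.trans_algEquiv {A E E' : Type} [Ring A] [Algebra F A] [Ring E]
    [Algebra F E] [Ring E'] [Algebra F E'] (h : IsBrauerEquiv F A E) (e : E ≃ₐ[F] E') :
    IsBrauerEquiv F A E' := by
  obtain ⟨n, m, hn, hm, ⟨f⟩⟩ := h
  exact ⟨n, m, hn, hm, ⟨f.trans e.mapMatrix⟩⟩

/-- Splitting off the first factor of a tensor product of algebras. -/
theorem nonempty_piTensorProduct_succ_algEquiv {k : ℕ} (H : Fin (k + 1) → Type*)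
    [∀ i, Ring (H i)] [∀ i, Algebra F (H i)] :
    Nonempty (H 0 ⊗[F] (⨂[F] i : Fin k, H i.succ) ≃ₐ[F] ⨂[F] i, H i) := by
  let c : H 0 →ₗ[F] MultilinearMap F (fun i : Fin k => H i.succ)
      (H 0 ⊗[F] (⨂[F] i : Fin k, H i.succ)) :=
    { toFun a := (TensorProduct.mk F (H 0) (⨂[F] i : Fin k, H i.succ) a).compMultilinearMap
        (PiTensorProduct.tprod F)
      map_add' a b := by ext; simp
      map_smul' r a := by ext; simp [TensorProduct.smul_tmul'] }
  let f : (⨂[F] i, H i) →ₐ[F] H 0 ⊗[F] (⨂[F] i : Fin k, H i.succ) :=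
    PiTensorProduct.liftAlgHom c.uncurryLeft (by simp [c]; rfl) (fun x y => by
      simp [c]
      rfl)
  have hf (x : ∀ i, H i) : f (PiTensorProduct.tprod F x) =
      x 0 ⊗ₜ PiTensorProduct.tprod F (Fin.tail x) := by
    simp [f, c, PiTensorProduct.liftAlgHom]
  let g : H 0 ⊗[F] (⨂[F] i : Fin k, H i.succ) →ₗ[F] ⨂[F] i, H i :=
    TensorProduct.lift ((PiTensorProduct.lift (R := F)).toLinearMap ∘ₗ
      (PiTensorProduct.tprod F (s := H)).curryLeft)
  have hg (a : H 0) (y : ∀ i : Fin k, H i.succ) :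
      g (a ⊗ₜ PiTensorProduct.tprod F y) = PiTensorProduct.tprod F (Fin.cons a y : ∀ i, H i) := by
    simp [g]
  have hgf : g ∘ₗ f.toLinearMap = LinearMap.id := by
    ext x
    simp [hf, hg]
  have hfg : f.toLinearMap ∘ₗ g = LinearMap.id := by
    refine TensorProduct.ext' fun a y => ?_
    induction y using PiTensorProduct.induction_on with
    | smul_tprod r y => simp [hf, hg]
    | add x y hx hy => simp only [TensorProduct.tmul_add, map_add, hx, hy]
  exact ⟨(AlgEquiv.ofBijective f ⟨Function.LeftInverse.injective (g := g)
    fun x => LinearMap.congr_fun hgf x, Function.RightInverse.surjective (g := g)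
    fun x => LinearMap.congr_fun hfg x⟩).symm⟩

theorem nonempty_piTensorProduct_zero_algEquiv (H : Fin 0 → Type*)
    [∀ i, Ring (H i)] [∀ i, Algebra F (H i)] : Nonempty (F ≃ₐ[F] ⨂[F] i, H i) := by
  refine ⟨AlgEquiv.ofBijective (Algebra.ofId F _) ?_⟩
  have : (Algebra.ofId F (⨂[F] i, H i) : F → ⨂[F] i, H i) =
      (PiTensorProduct.isEmptyEquiv (R := F) (s := H) (Fin 0)).symm := by
    ext r
    rw [Algebra.ofId_apply, Algebra.algebraMap_eq_smul_one]
    simp [PiTensorProduct.one_def, PiTensorProduct.isEmptyEquiv]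
    congr
    ext i
    exact i.elim0
  rw [this]
  exact LinearEquiv.bijective _

end Brauer

section Quaternion

variable {F : Type} [Field F] [CharP F 2] {a b : F}

theorem isCyclicPAlg_quaternionAlgebra (hb : b ≠ 0) : IsCyclicPAlg 2 F ℍ[F,a,1,b] := by
  refine ⟨a, b, hb, QuaternionAlgebra.finrank_eq_four _ _ _, ⟨0, 1, 0, 0⟩, ⟨0, 0, 1, 0⟩,
    ?_, ?_, ?_, ?_⟩
  · ext <;> simp [sq]
  · ext <;> simp [sq]
  · ext <;> simp [CharTwo.neg_eq]
  · refine eq_top_iff.2 fun q _ => ?_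
    have hi : (⟨0, 1, 0, 0⟩ : ℍ[F,a,1,b]) ∈ Algebra.adjoin F
      {(⟨0, 1, 0, 0⟩ : ℍ[F,a,1,b]), ⟨0, 0, 1, 0⟩} := Algebra.subset_adjoin (by simp)
    have hj : (⟨0, 0, 1, 0⟩ : ℍ[F,a,1,b]) ∈ Algebra.adjoin F
      {(⟨0, 1, 0, 0⟩ : ℍ[F,a,1,b]), ⟨0, 0, 1, 0⟩} := Algebra.subset_adjoin (by simp)
    have : q = q.re • 1 + q.imI • ⟨0, 1, 0, 0⟩ + q.imJ • ⟨0, 0, 1, 0⟩ +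
        q.imK • (⟨0, 1, 0, 0⟩ * ⟨0, 0, 1, 0⟩) := by
      ext <;> simp
    rw [this]
    exact add_mem (add_mem (add_mem (Subalgebra.smul_mem _ (one_mem _) _)
      (Subalgebra.smul_mem _ hi _)) (Subalgebra.smul_mem _ hj _))
      (Subalgebra.smul_mem _ (mul_mem hi hj) _)

instance isCentral_quaternionAlgebra : Algebra.IsCentral F ℍ[F,a,1,b] := by
  refine ⟨fun q hq => Algebra.mem_bot.2 ⟨q.re, ?_⟩⟩
  rw [Subalgebra.mem_center_iff] at hq
  have hi := hq ⟨0, 1, 0, 0⟩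
  have hj := hq ⟨0, 0, 1, 0⟩
  rw [QuaternionAlgebra.ext_iff] at hi hj
  simp [CharTwo.neg_eq] at hi hj
  ext <;> simp <;> grind

theorem isSimpleRing_quaternionAlgebra (hb : b ≠ 0) : IsSimpleRing ℍ[F,a,1,b] := by
  refine IsSimpleRing.of_eq_bot_or_eq_top fun I => or_iff_not_imp_left.2 fun hI => ?_
  rw [← TwoSidedIdeal.one_mem_iff]
  obtain ⟨q, hqI, hq0⟩ : ∃ q ∈ I, q ≠ 0 := by
    by_contra! h
    exact hI (TwoSidedIdeal.ext fun x => ⟨fun hx => (TwoSidedIdeal.mem_bot _).2 (h x hx),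
      fun hx => by rw [(TwoSidedIdeal.mem_bot _).1 hx]; exact I.zero_mem⟩)
  have hc (p q : ℍ[F,a,1,b]) (hq : q ∈ I) : p * q - q * p ∈ I :=
    I.sub_mem (I.mul_mem_left _ _ hq) (I.mul_mem_right _ _ hq)
  have hs (x y : F) (h : (⟨x, y, 0, 0⟩ : ℍ[F,a,1,b]) ∈ I) (hne : ¬ (x = 0 ∧ y = 0)) :
      (1 : ℍ[F,a,1,b]) ∈ I := by
    by_cases hy : y = 0
    · subst hy
      have hx : x ≠ 0 := fun hx => hne ⟨hx, rfl⟩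
      have := I.mul_mem_left ⟨x⁻¹, 0, 0, 0⟩ _ h
      convert this
      ext <;> simp [hx]
    · have := I.mul_mem_left ⟨0, 0, (b * y)⁻¹, 0⟩ _ (hc ⟨0, 0, 1, 0⟩ _ h)
      convert this
      ext <;> simp [CharTwo.neg_eq]
      field_simp
  have h1 : (⟨0, 0, q.imJ, q.imK⟩ : ℍ[F,a,1,b]) ∈ I := by
    convert hc ⟨0, 1, 0, 0⟩ q hqI using 1
    ext <;> simp [CharTwo.sub_eq_add] <;> grind
  by_cases h0 : q.imJ = 0 ∧ q.imK = 0
  · refine hs q.re q.imI ?_ fun h => hq0 ?_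
    · convert I.sub_mem hqI h1 using 1
      ext <;> simp
    · ext <;> simp [h0, h]
  · refine hs (b * q.imJ) (b * q.imK) ?_ (by simpa [hb] using h0)
    convert I.mul_mem_right _ ⟨0, 0, 1, 0⟩ h1 using 1
    ext <;> simp

end Quaternion

section Decomposition

variable {F : Type} [Field F]

/-- One quaternion algebra can be split off by halving the degree of the splitting field. -/
theorem exists_quaternion_step [CharP F 2] {A : Type} [Ring A] [Algebra F A] [Algebra.IsCentral F A]
    [IsSimpleRing A] [FiniteDimensional F A] {r : ℕ} (h1 : 1 < r)
    (hA : HasExponentOneSplitting F A r) :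
    ∃ a b : F, b ≠ 0 ∧ ∃ s, 2 * s ≤ r ∧ HasExponentOneSplitting F (A ⊗[F] ℍ[F,a,1,b]) s := by
  obtain ⟨K, _, _, V, _, _, _, _, φ, _, _, hK, h, rfl⟩ := hA
  have : CharP K 2 := charP_of_injective_algebraMap (algebraMap F K).injective 2
  have hV (v : V) : v + v = 0 := by
    rw [← two_smul K v, CharTwo.two_eq_zero, zero_smul]
  obtain ⟨x, hx⟩ : ∃ x : K, x ∉ (⊥ : IntermediateField F K) := by
    by_contra! hx
    have : (⊥ : IntermediateField F K) = ⊤ := eq_top_iff.2 fun z _ => hx z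
    have h2 := IntermediateField.finrank_top' (F := F) (E := K)
    rw [← this, IntermediateField.finrank_bot] at h2
    omega
  obtain ⟨M, -, hxM, hM⟩ := exists_maximal_notMem hK ⊥ x hx
  obtain ⟨δ, hδx, hδM, hδδ⟩ := exists_derivation hK M x hxM hM
  obtain ⟨U, hUa, hUk⟩ := exists_connection φ h
  replace hUa := hUa δ
  replace hUk := hUk δ
  generalize U δ = u at hUa hUk
  have hnt : Nontrivial V := nontrivial_of_finrank_eq_sq h
  -- the curvature `u ^ 2 + u` is a scalar `y ∈ M`
  let f : Module.End K V :=
    { toFun v := u (u v) + u v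
      map_add' v w := by simp only [map_add]; abel
      map_smul' k v := by
        have := hV (δ k • u v)
        have h2 := hV (δ k • v)
        simp only [hUk, map_add, hδδ, smul_add, RingHom.id_apply]
        rw [show k • u (u v) + δ k • u v + (δ k • u v + δ k • v) + (k • u v + δ k • v) =
          k • u (u v) + k • u v + (δ k • u v + δ k • u v) + (δ k • v + δ k • v) by abel, this, h2,
          add_zero, add_zero] }
  obtain ⟨y, hy⟩ := exists_smul_of_commute φ h f fun a v => by simp [f, hUa]
  replace hy (v : V) : u (u v) + u v = y • v := hy v
  have hyM : δ y = 0 := by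
    obtain ⟨v, hv⟩ := exists_ne (0 : V)
    have h2 := congrArg u (hy v)
    rw [map_add, hy (u v), hUk] at h2
    exact (smul_eq_zero.1 (left_eq_add.1 h2)).resolve_right hv
  obtain ⟨e, he⟩ := hK y
  obtain ⟨c, hc⟩ := hK x
  have hx0 : x ≠ 0 := fun h => hxM (h ▸ M.zero_mem)
  have hc0 : c ≠ 0 := by
    rintro rfl
    exact pow_ne_zero 2 hx0 (by rw [← hc, map_zero])
  have : IsScalarTower F M V :=
    ⟨fun a k v => by
      change ((a • k : M) : K) • v = a • ((k : K) • v)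
      rw [IntermediateField.coe_smul, smul_assoc]⟩
  let I : Module.End M V :=
    { toFun v := u v + y • v
      map_add' v w := by simp only [map_add, smul_add]; abel
      map_smul' k v := by
        change u ((k : K) • v) + y • (k : K) • v = (k : K) • (u v + y • v)
        rw [hUk, (hδM k).2 k.2, smul_add, smul_comm y]; simp }
  let J : Module.End M V :=
    { toFun v := x • v
      map_add' v w := smul_add _ _ _
      map_smul' k v := smul_comm _ _ _ }
  have hI (v : V) : I v = u v + y • v := rfl
  have hJ (v : V) : J v = x • v := rfl
  have hIJ (v : V) : I (J v) = J (I v) + J v := by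
    simp only [hI, hJ, hUk, hδx, smul_add, smul_comm y x v]; abel
  let B : QuaternionAlgebra.Basis (Module.End M V) e 1 c :=
    { i := I
      j := J
      k := I * J
      i_mul_i := by
        ext v
        change I (I v) = e • v + (1 : F) • I v
        rw [← algebraMap_smul K e v, he, one_smul]
        simp only [hI, map_add, hUk, hyM, zero_smul, add_zero, smul_add]
        have h2 : u v + y • v = u (u v) := by
          rw [← hy v, add_left_comm, hV, add_zero]
        rw [h2, sq, mul_smul, ← add_assoc, add_assoc (u (u v)), hV, add_zero, add_comm]
      j_mul_j := by
        ext v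
        change x • x • v = c • v
        rw [← algebraMap_smul K c v, hc, sq, mul_smul]
      i_mul_j := rfl
      j_mul_i := by
        ext v
        change J (I v) = (1 : F) • J v - I (J v)
        rw [hIJ, one_smul, sub_add_cancel_right, eq_neg_iff_add_eq_zero, hV] }
  let φ' : A →ₐ[F] Module.End M V :=
    { toFun a := (φ a).restrictScalars M
      map_one' := by ext; simp
      map_mul' a b := by ext; simp
      map_zero' := by ext; simp
      map_add' a b := by ext; simp
      commutes' r := by ext v; simp [Module.algebraMap_end_apply] }
  have hφI (a : A) : Commute (φ' a) I := by
    ext v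
    change φ a (u v + y • v) = u (φ a v) + y • φ a v
    rw [map_add, map_smul, hUa]
  have hφJ (a : A) : Commute (φ' a) J := by
    ext v
    exact (φ a).map_smul x v
  let ψ : A ⊗[F] ℍ[F,e,1,c] →ₐ[F] Module.End M V :=
    Algebra.TensorProduct.lift φ' B.liftHom fun a q => by
      change Commute (φ' a) (algebraMap F _ q.re + q.imI • I + q.imJ • J + q.imK • (I * J))
      exact (((Algebra.commute_algebraMap_right _ _).add_right ((hφI a).smul_right _)).add_right
        ((hφJ a).smul_right _)).add_right (((hφI a).mul_right (hφJ a)).smul_right _)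
  have hMK : Module.finrank M K ≤ 2 := by
    let g : (M × M) →ₗ[M] K :=
      { toFun p := p.1 + p.2 * x
        map_add' p q := by simp; ring
        map_smul' k p := by simp [IntermediateField.smul_def]; ring }
    have hg : Function.Surjective g := fun z => by
      obtain ⟨a, ha, b, hb, rfl⟩ := hM z
      exact ⟨(⟨a, ha⟩, ⟨b, hb⟩), rfl⟩
    have := LinearMap.finrank_le_finrank_of_surjective hg
    rwa [Module.finrank_prod, Module.finrank_self] at this
  have hMK' : 2 ≤ Module.finrank M K := by
    have h2 : 0 < Module.finrank M K := Module.finrank_pos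
    have h3 : Module.finrank M K ≠ 1 := fun h3 => hxM <| by
      rw [IntermediateField.finrank_eq_one_iff_eq_top.1 h3]; trivial
    omega
  have : FiniteDimensional M V := FiniteDimensional.trans M K V
  have hMV : Module.finrank M V ≤ 2 * Module.finrank K V := by
    rw [← Module.finrank_mul_finrank M K V]
    exact Nat.mul_le_mul_right _ hMK
  have := isSimpleRing_quaternionAlgebra (a := e) hc0
  have hdim : Module.finrank F (A ⊗[F] ℍ[F,e,1,c]) = 4 * Module.finrank F A := by
    rw [Module.finrank_tensorProduct, QuaternionAlgebra.finrank_eq_four, mul_comm]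
  refine ⟨e, c, hc0, Module.finrank F M, ?_, M, inferInstance, inferInstance, V, inferInstance,
    inferInstance, inferInstance, inferInstance, ψ, inferInstance, inferInstance, fun z => ?_,
    le_antisymm (finrank_le_sq_of_algHom ψ) ?_, rfl⟩
  · rw [← Module.finrank_mul_finrank F M K, mul_comm]
    exact Nat.mul_le_mul_left _ hMK'
  · obtain ⟨c, hc⟩ := hK z
    exact ⟨c, Subtype.ext hc⟩
  · rw [hdim, h]
    calc _ ≤ (2 * Module.finrank K V) ^ 2 := Nat.pow_le_pow_left hMV 2
      _ = _ := by ring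

theorem exists_matrix_of_finrank_eq_one {A : Type} [Ring A] [Algebra F A] [Algebra.IsCentral F A]
    [IsSimpleRing A] [FiniteDimensional F A] {r : ℕ} (h1 : r ≤ 1)
    (hA : HasExponentOneSplitting F A r) :
    ∃ n, 0 < n ∧ Nonempty (A ≃ₐ[F] Matrix (Fin n) (Fin n) F) := by
  obtain ⟨K, _, _, V, _, _, _, _, φ, _, _, hK, h, rfl⟩ := hA
  have h0 : 0 < Module.finrank F K := Module.finrank_pos
  have hV : Module.finrank F V = Module.finrank K V := by
    rw [← Module.finrank_mul_finrank F K V, show Module.finrank F K = 1 by omega, one_mul]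
  have hnt : Nontrivial V := nontrivial_of_finrank_eq_sq h
  have : FiniteDimensional F V := FiniteDimensional.trans F K V
  let φ' : A →ₐ[F] Module.End F V :=
    { toFun a := (φ a).restrictScalars F
      map_one' := by ext; simp
      map_mul' a b := by ext; simp
      map_zero' := by ext; simp
      map_add' a b := by ext; simp
      commutes' r := by ext v; simp [Module.algebraMap_end_apply] }
  have hinj : Function.Injective φ' := φ'.toRingHom.injective
  have hsurj : Function.Surjective φ' :=
    (LinearMap.injective_iff_surjective_of_finrank_eq_finrank (f := φ'.toLinearMap) (by
      rw [Module.finrank_linearMap, h, hV, sq])).1 hinj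
  exact ⟨_, Module.finrank_pos (R := F) (M := V),
    ⟨(AlgEquiv.ofBijective φ' ⟨hinj, hsurj⟩).trans (algEquivMatrix (Module.finBasis F V))⟩⟩

theorem exists_quaternion_decomposition [CharP F 2] (r : ℕ) : ∀ (A : Type) [Ring A] [Algebra F A]
    [Algebra.IsCentral F A] [IsSimpleRing A] [FiniteDimensional F A],
    (∃ s ≤ 2 ^ r, HasExponentOneSplitting F A s) →
    ∃ k ≤ r, ∃ a b : Fin k → F, (∀ i, b i ≠ 0) ∧
      IsBrauerEquiv F A (⨂[F] i, ℍ[F,a i,1,b i]) := by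
  have base (A : Type) [Ring A] [Algebra F A] [Algebra.IsCentral F A] [IsSimpleRing A]
      [FiniteDimensional F A] (s : ℕ) (hs : s ≤ 1) (hA : HasExponentOneSplitting F A s) :
      ∃ a b : Fin 0 → F, (∀ i, b i ≠ 0) ∧ IsBrauerEquiv F A (⨂[F] i, ℍ[F,a i,1,b i]) := by
    obtain ⟨n, hn, ⟨f⟩⟩ := exists_matrix_of_finrank_eq_one hs hA
    obtain ⟨g⟩ := nonempty_piTensorProduct_zero_algEquiv (F := F)
      (fun i : Fin 0 => ℍ[F,(Fin.elim0 i : F),1,(Fin.elim0 i : F)])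
    refine ⟨fun i => i.elim0, fun i => i.elim0, fun i => i.elim0, 1, n, one_pos, hn, ⟨?_⟩⟩
    exact f.mapMatrix.trans <| (Matrix.compAlgEquiv (Fin 1) (Fin n) F F).trans <|
      (Matrix.reindexAlgEquiv F F (Equiv.uniqueProd (Fin n) (Fin 1))).trans g.mapMatrix
  induction r with
  | zero =>
    rintro A _ _ _ _ _ ⟨s, hs, hA⟩
    exact ⟨0, le_rfl, base A s (by simpa using hs) hA⟩
  | succ r ih =>
    rintro A _ _ _ _ _ ⟨s, hs, hA⟩
    by_cases hs1 : s ≤ 1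
    · exact ⟨0, Nat.zero_le _, base A s hs1 hA⟩
    obtain ⟨a₀, b₀, hb₀, t, hts, hA'⟩ := exists_quaternion_step (not_le.1 hs1) hA
    have := isSimpleRing_quaternionAlgebra (a := a₀) hb₀
    obtain ⟨k, hk, a, b, hb, hE⟩ := ih (A ⊗[F] ℍ[F,a₀,1,b₀]) ⟨t, by rw [pow_succ] at hs; omega, hA'⟩
    obtain ⟨g⟩ := nonempty_piTensorProduct_succ_algEquiv (F := F)
      (fun i : Fin (k + 1) => ℍ[F,(Fin.cons a₀ a : Fin (k + 1) → F) i,1,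
        (Fin.cons b₀ b : Fin (k + 1) → F) i])
    refine ⟨k + 1, by omega, Fin.cons a₀ a, Fin.cons b₀ b, Fin.cases hb₀ hb, ?_⟩
    exact (IsBrauerEquiv.of_tensor_left QuaternionAlgebra.starAe hE).trans_algEquiv g

end Decomposition

section Homotopies

variable {F V : Type*} [Field F] [AddCommGroup V] [Module F V]

/-- In characteristic `2`, a semisimple nonscalar square root of a scalar is nullhomotopic. -/
theorem exists_mul_add_mul_eq_self [CharP F 2] (γ : Module.End F V) (c : F)
    (hγ : γ * γ = algebraMap F _ c) (hc : ∀ m : F, m ^ 2 ≠ c) :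
    ∃ Z : Module.End F V, γ * Z + Z * γ = γ := by
  have : Fact (Irreducible (Polynomial.X ^ 2 - Polynomial.C c)) :=
    ⟨X_pow_sub_C_irreducible_of_prime Nat.prime_two hc⟩
  let E := AdjoinRoot (Polynomial.X ^ 2 - Polynomial.C c)
  let x : E := AdjoinRoot.root _
  have hx2 : x ^ 2 = algebraMap F E c := by
    have := AdjoinRoot.eval₂_root (Polynomial.X ^ 2 - Polynomial.C c)
    simp only [Polynomial.eval₂_sub, Polynomial.eval₂_pow, Polynomial.eval₂_X,
      Polynomial.eval₂_C, sub_eq_zero] at this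
    exact this
  have : CharP E 2 := charP_of_injective_algebraMap (algebraMap F E).injective 2
  have hK (z : E) : z ^ 2 ∈ (algebraMap F E).range := by
    have hz : z ∈ Algebra.adjoin F {x} := by
      rw [AdjoinRoot.adjoinRoot_eq_top]; trivial
    induction hz using Algebra.adjoin_induction with
    | mem y hy => rw [Set.mem_singleton_iff.1 hy]; exact ⟨c, hx2.symm⟩
    | algebraMap r => exact ⟨r ^ 2, map_pow _ _ _⟩
    | add y z _ _ hy hz => rw [CharTwo.add_sq]; exact add_mem hy hz
    | mul y z _ _ hy hz => rw [mul_pow]; exact mul_mem hy hz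
  have hxM : x ∉ (⊥ : IntermediateField F E) := by
    rw [IntermediateField.mem_bot]
    rintro ⟨m, hm⟩
    refine hc m ((algebraMap F E).injective ?_)
    rw [map_pow, hm, hx2]
  have hM (z : E) : ∃ a ∈ (⊥ : IntermediateField F E), ∃ b ∈ (⊥ : IntermediateField F E),
      z = a + b * x := by
    have h1 : Algebra.adjoin F {x} ≤ (quadExt hK ⊥ x).toSubalgebra :=
      Algebra.adjoin_le (Set.singleton_subset_iff.2 self_mem_quadExt)
    rw [AdjoinRoot.adjoinRoot_eq_top] at h1
    exact mem_quadExt.1 (h1 (Algebra.mem_top (x := z)))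
  obtain ⟨δ, hδ, -, -⟩ := exists_derivation hK ⊥ x hxM hM
  let φ : E →ₐ[F] Module.End F V := Ideal.Quotient.liftₐ _ (Polynomial.aeval γ) fun p hp => by
    obtain ⟨q, rfl⟩ := Ideal.mem_span_singleton'.1 hp
    simp [pow_two, hγ]
  have hφ : φ x = γ := Polynomial.aeval_X γ
  let : Module E V := Module.compHom V φ.toRingHom
  have hsmul (k : E) (v : V) : k • v = φ k v := rfl
  have : IsScalarTower F E V := ⟨fun r k v => by simp [hsmul]⟩
  let b := Module.Basis.ofVectorSpace E V
  let Z : Module.End F V :=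
    { toFun v := (b.repr v).sum fun i k => δ k • b i
      map_add' v w := by
        rw [map_add, Finsupp.sum_add_index'] <;> simp [add_smul]
      map_smul' r v := by
        rw [← algebraMap_smul E r v, map_smul, Finsupp.sum_smul_index (by simp), Finsupp.smul_sum]
        simp [mul_smul] }
  have hZ (k : E) (v : V) : Z (k • v) = k • Z v + δ k • v := by
    have hv : δ k • v = (b.repr v).sum fun i l => (l * δ k) • b i := by
      conv_lhs => rw [← b.linearCombination_repr v]
      simp [Finsupp.linearCombination_apply, Finsupp.smul_sum, smul_smul, mul_comm]
    rw [hv]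
    simp only [Z, LinearMap.coe_mk, AddHom.coe_mk]
    rw [map_smul, Finsupp.sum_smul_index (by simp), Finsupp.smul_sum, ← Finsupp.sum_add]
    simp [add_smul, smul_smul]
  refine ⟨Z, LinearMap.ext fun v => ?_⟩
  have h2 := hZ x v
  rw [hδ, hsmul, hsmul, hφ] at h2
  have h3 (w : V) : w + w = 0 := by
    rw [← two_smul F, CharTwo.two_eq_zero, zero_smul]
  simp only [LinearMap.add_apply, Module.End.mul_apply, h2]
  rw [← add_assoc, h3, zero_add]

/-- An exact differential of a vector space is contractible. -/
theorem exists_mul_add_mul_eq_one (ν : Module.End F V) (hν : ν * ν = 0)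
    (h : LinearMap.ker ν ≤ LinearMap.range ν) :
    ∃ Y : Module.End F V, ν * Y + Y * ν = 1 := by
  obtain ⟨s, hs⟩ := ν.rangeRestrict.exists_rightInverse_of_surjective ν.range_rangeRestrict
  obtain ⟨p, hp⟩ := (LinearMap.range ν).subtype.exists_leftInverse_of_injective
    (Submodule.ker_subtype _)
  let σ : Module.End F V := s ∘ₗ p
  have hσ (v : V) : ν (σ (ν v)) = ν v := by
    have h1 : p (ν v) = ν.rangeRestrict v := DFunLike.congr_fun hp (ν.rangeRestrict v)
    have h2 := congrArg Subtype.val (DFunLike.congr_fun hs (ν.rangeRestrict v))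
    simpa [σ, h1] using h2
  have hνν (v : V) : ν (ν v) = 0 := DFunLike.congr_fun hν v
  refine ⟨σ - σ * σ * ν, LinearMap.ext fun v => ?_⟩
  obtain ⟨w, hw⟩ := h (x := v - σ (ν v)) (by simp [hσ])
  have h3 : ν (σ (v - σ (ν v))) = v - σ (ν v) := by rw [← hw, hσ]
  simp only [LinearMap.add_apply, Module.End.mul_apply, LinearMap.sub_apply, hνν, map_zero,
    sub_zero, Module.End.one_apply]
  rw [← map_sub, h3, sub_add_cancel]

end Homotopies

section TensorSquare

/-- Symmetric tensors are sums of squares and norms. -/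
theorem exists_symmetric_tensor_eq {F M : Type*} [Field F] [AddCommGroup M] [Module F M] {n : ℕ}
    (b : Module.Basis (Fin n) F M) (z : M ⊗[F] M) (hz : TensorProduct.comm F M M z = z) :
    ∃ (c : Fin n → F) (y : M ⊗[F] M),
      z = ∑ i, c i • (b i ⊗ₜ b i) + (y + TensorProduct.comm F M M y) := by
  let B := b.tensorProduct b
  let t (i j : Fin n) : F := B.repr z (i, j)
  have hsymm (w : M ⊗[F] M) (i j : Fin n) :
      B.repr (TensorProduct.comm F M M w) (i, j) = B.repr w (j, i) := by
    induction w with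
    | zero => simp
    | tmul x y => simp [B, mul_comm]
    | add x y hx hy => simp [hx, hy]
  have ht (i j : Fin n) : t i j = t j i := by
    have := hsymm z i j
    rwa [hz] at this
  have hsum : z = ∑ i, ∑ j, t i j • (b i ⊗ₜ b j) := by
    conv_lhs => rw [← B.sum_repr z]
    rw [Fintype.sum_prod_type]
    simp [B, t]
  refine ⟨fun i => t i i, ∑ i, ∑ j, (if i < j then t i j else 0) • (b i ⊗ₜ b j), ?_⟩
  have hcomm : TensorProduct.comm F M M
      (∑ i, ∑ j, (if i < j then t i j else 0) • (b i ⊗ₜ[F] b j)) =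
      ∑ i, ∑ j, (if j < i then t i j else 0) • (b i ⊗ₜ[F] b j) := by
    simp only [map_sum, map_smul, TensorProduct.comm_tmul]
    rw [Finset.sum_comm]
    refine Finset.sum_congr rfl fun i _ => Finset.sum_congr rfl fun j _ => ?_
    rw [ht]
  have hdiag : ∑ i, t i i • (b i ⊗ₜ[F] b i) =
      ∑ i, ∑ j, (if i = j then t i j else 0) • (b i ⊗ₜ[F] b j) := by
    simp
  rw [hcomm, hdiag]
  conv_lhs => rw [hsum]
  simp only [← Finset.sum_add_distrib, ← add_smul]
  refine Finset.sum_congr rfl fun i _ => Finset.sum_congr rfl fun j _ => ?_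
  congr 1
  rcases lt_trichotomy i j with h | h | h
  · simp [h, h.ne, h.not_gt]
  · simp [h]
  · simp [h, h.ne', h.not_gt]

variable {F A V : Type*} [Field F] [Ring A] [Algebra F A] [AddCommGroup V] [Module F V]

theorem add_comm_ne_one [CharP F 2] [Nontrivial A] (y : A ⊗[F] A) :
    y + Algebra.TensorProduct.comm F A A y ≠ 1 := by
  obtain ⟨f, hf⟩ := Module.Projective.exists_dual_eq_one F (one_ne_zero (α := A))
  let g : A ⊗[F] A →ₗ[F] F := LinearMap.mul' F F ∘ₗ TensorProduct.map f f
  have hg (w : A ⊗[F] A) : g (Algebra.TensorProduct.comm F A A w) = g w := by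
    induction w with
    | zero => simp
    | tmul x y => simp [g, mul_comm]
    | add x y hx hy => simp only [map_add, hx, hy]
  intro h
  have := congrArg g h
  rw [map_add, hg, CharTwo.add_self_eq_zero] at this
  simp [g, Algebra.TensorProduct.one_def, hf] at this

/-- If `A ⊗ A` is split in characteristic `2`, the exchange involution is conjugation by an
involution. -/
theorem exists_exchange_involution [CharP F 2] [Nontrivial A] [FiniteDimensional F V]
    (θ : A ⊗[F] A ≃ₐ[F] Module.End F V) :
    ∃ γ : Module.End F V, γ * γ = 1 ∧ (∀ Z, γ * Z + Z * γ ≠ γ) ∧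
      ∀ z, θ (Algebra.TensorProduct.comm F A A z) * γ = γ * θ z := by
  let τ := Algebra.TensorProduct.comm F A A
  have hττ (z : A ⊗[F] A) : τ (τ z) = z := τ.left_inv z
  obtain ⟨T, hT⟩ := AlgEquiv.eq_linearEquivConjAlgEquiv (θ.symm.trans (τ.trans θ))
  let γ : Module.End F V := T
  have hγ (z : A ⊗[F] A) : θ (τ z) * γ = γ * θ z := by
    have := DFunLike.congr_fun hT (θ z)
    simp only [AlgEquiv.trans_apply, AlgEquiv.symm_apply_apply] at this
    rw [this]
    ext v
    simp [γ, LinearEquiv.conjAlgEquiv_apply]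
  have hinj (X Y : Module.End F V) (h : γ * X = γ * Y) : X = Y := by
    ext v
    exact T.injective (DFunLike.congr_fun h v)
  have hZ (Z : Module.End F V) : γ * Z + Z * γ ≠ γ := by
    obtain ⟨y, rfl⟩ := θ.surjective Z
    intro h
    have h1 : θ y * γ = γ * θ (τ y) := by rw [← hγ, hττ]
    rw [h1, ← mul_add, ← map_add] at h
    refine add_comm_ne_one y (θ.injective (hinj _ _ ?_))
    rw [h, map_one, mul_one]
  have hcent : γ * γ ∈ Subalgebra.center F (Module.End F V) := by
    rw [Subalgebra.mem_center_iff]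
    intro X
    obtain ⟨y, rfl⟩ := θ.surjective X
    rw [← hττ y, ← mul_assoc, hγ, mul_assoc, hγ, mul_assoc, hττ]
  rw [Algebra.IsCentral.center_eq_bot, Algebra.mem_bot] at hcent
  obtain ⟨c, hc⟩ := hcent
  by_cases hsq : ∀ m : F, m ^ 2 ≠ c
  · obtain ⟨Z, h⟩ := exists_mul_add_mul_eq_self γ c hc.symm hsq
    exact absurd h (hZ Z)
  push Not at hsq
  obtain ⟨m, rfl⟩ := hsq
  have hm : m ≠ 0 := by
    rintro rfl
    have h0 : γ = 0 := hinj _ _ (by rw [← hc]; simp)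
    exact hZ 0 (by simp [h0])
  refine ⟨m⁻¹ • γ, ?_, fun Z h => hZ Z ?_, fun z => ?_⟩
  · rw [smul_mul_smul_comm, ← hc, Algebra.algebraMap_eq_smul_one, smul_smul]
    field_simp
    simp
  · rw [smul_mul_assoc, mul_smul_comm, ← smul_add] at h
    exact smul_right_injective _ (inv_ne_zero hm) h
  · rw [mul_smul_comm, smul_mul_assoc]
    exact congrArg _ (hγ z)

end TensorSquare

section FrobeniusRepresentations

/-- If `A ⊗ A` is split in characteristic `2`, the Frobenius twist of `A` has a representation
of dimension at most the degree of `A`. -/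
theorem exists_frobenius_representation {F A V : Type} [Field F] [CharP F 2] [Ring A]
    [Algebra F A] [Nontrivial A] [FiniteDimensional F A] [AddCommGroup V] [Module F V]
    [FiniteDimensional F V] (θ : A ⊗[F] A ≃ₐ[F] Module.End F V) :
    ∃ (W : Type) (_ : AddCommGroup W) (_ : Module F W) (ρ : A →+* Module.End F W),
      FiniteDimensional F W ∧ Nontrivial W ∧
      (∀ (c : F) (a : A), ρ (c • a) = c ^ 2 • ρ a) ∧
      Module.finrank F W ^ 2 ≤ Module.finrank F A := by
  obtain ⟨γ, hγ2, hZ, hγ⟩ := exists_exchange_involution θ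
  have hVV (v : V) : v + v = 0 := by
    rw [← two_smul F, CharTwo.two_eq_zero, zero_smul]
  have hEnd (X : Module.End F V) : X + X = 0 := LinearMap.ext fun v => hVV (X v)
  let ν : Module.End F V := γ + 1
  have hνv (v : V) : ν v = γ v + v := rfl
  have hνν : ν * ν = 0 := by
    change (γ + 1) * (γ + 1) = 0
    rw [mul_add, add_mul, hγ2, mul_one, one_mul, add_comm γ 1]
    exact hEnd _
  let R := LinearMap.ker ν
  let N : Submodule F R := (LinearMap.range ν).comap R.subtype
  have hR (v : V) (hv : v ∈ R) : γ v = v := by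
    have h1 : γ v + v = 0 := hv
    exact add_right_cancel (h1.trans (hVV v).symm)
  have hnorm (y : A ⊗[F] A) (v : V) (hv : v ∈ R) :
      θ (y + Algebra.TensorProduct.comm F A A y) v = ν (θ y v) := by
    have := DFunLike.congr_fun (hγ y) v
    simp only [Module.End.mul_apply, hR v hv] at this
    rw [map_add, LinearMap.add_apply, this, hνv, add_comm]
  have hsq (a : A) : θ (a ⊗ₜ a) * ν = ν * θ (a ⊗ₜ a) := by
    have := hγ (a ⊗ₜ a)
    rw [Algebra.TensorProduct.comm_tmul] at this
    simp only [ν, mul_add, add_mul, this, mul_one, one_mul]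
  have hsqv (a : A) (v : V) : θ (a ⊗ₜ a) (ν v) = ν (θ (a ⊗ₜ a) v) := DFunLike.congr_fun (hsq a) v
  have hresR (a : A) : ∀ v ∈ R, θ (a ⊗ₜ a) v ∈ R := fun v hv => by
    rw [LinearMap.mem_ker] at hv ⊢
    rw [← hsqv, hv, map_zero]
  have hresN (a : A) : N ≤ N.comap ((θ (a ⊗ₜ a)).restrict (hresR a)) := by
    rintro ⟨v, hv⟩ ⟨w, hw⟩
    exact ⟨θ (a ⊗ₜ a) w, by rw [← hsqv, hw]; rfl⟩
  let r (a : A) : Module.End F (R ⧸ N) := N.mapQ N ((θ (a ⊗ₜ a)).restrict (hresR a)) (hresN a)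
  have hr (a : A) (v : R) : r a (N.mkQ v) = N.mkQ ⟨θ (a ⊗ₜ a) v, hresR a v v.2⟩ := rfl
  have hmk (v w : R) (u : V) (h : (v : V) = w + ν u) : N.mkQ v = N.mkQ w := by
    refine (Submodule.Quotient.eq N).2 ⟨u, ?_⟩
    simp [h]
  have hext (X Y : Module.End F (R ⧸ N)) (h : ∀ v, X (N.mkQ v) = Y (N.mkQ v)) : X = Y :=
    LinearMap.ext fun w => by
      obtain ⟨v, rfl⟩ := N.mkQ_surjective w
      exact h v
  let ρ : A →+* Module.End F (R ⧸ N) :=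
    { toFun := r
      map_one' := hext _ _ fun v => hmk _ _ 0 <| by
        simp [← Algebra.TensorProduct.one_def]
      map_mul' a b := hext _ _ fun v => hmk _ _ 0 <| by
        simp [← Algebra.TensorProduct.tmul_mul_tmul]
      map_zero' := hext _ _ fun v => hmk _ _ 0 <| by simp
      map_add' a b := hext _ _ fun v => by
        refine hmk _ ⟨θ (a ⊗ₜ a) v + θ (b ⊗ₜ b) v, add_mem (hresR a v v.2) (hresR b v v.2)⟩
          (θ (a ⊗ₜ b) v) ?_
        rw [← hnorm _ _ v.2]
        change θ ((a + b) ⊗ₜ (a + b)) v = _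
        simp only [Algebra.TensorProduct.comm_tmul, TensorProduct.add_tmul,
          TensorProduct.tmul_add, map_add, LinearMap.add_apply]
        abel }
  have hρ (a : A) : ρ a = r a := rfl
  have hsmul (c : F) (a : A) : ρ (c • a) = c ^ 2 • ρ a := hext _ _ fun v => hmk _ _ 0 <| by
    change θ ((c • a) ⊗ₜ (c • a)) v = c ^ 2 • θ (a ⊗ₜ a) v + ν 0
    rw [TensorProduct.smul_tmul_smul, pow_two]
    simp
  refine ⟨R ⧸ N, inferInstance, inferInstance, ρ, inferInstance, ?_, hsmul, ?_⟩
  · by_contra hN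
    rw [Submodule.Quotient.nontrivial_iff, not_not] at hN
    obtain ⟨Y, hY⟩ := exists_mul_add_mul_eq_one ν hνν fun v hv => by
      have : (⟨v, hv⟩ : R) ∈ N := hN ▸ Submodule.mem_top
      exact this
    have h1 : γ * Y + Y * γ = 1 := by
      rw [← hY]
      simp only [ν, mul_add, add_mul, mul_one, one_mul]
      have := hEnd Y
      rw [add_add_add_comm, this, add_zero]
    refine hZ (γ * Y) ?_
    rw [mul_assoc, ← mul_add, h1, mul_one]
  · obtain ⟨s, hs⟩ := N.mkQ.exists_rightInverse_of_surjective N.range_mkQ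
    obtain ⟨p, hp⟩ := R.subtype.exists_leftInverse_of_injective R.ker_subtype
    let b := Module.finBasis F A
    let Φ : (Fin (Module.finrank F A) → F) →ₗ[F] Module.End F (R ⧸ N) :=
      Fintype.linearCombination F fun i => ρ (b i)
    have hΦ : Function.Surjective Φ := by
      intro f
      let X : Module.End F V := R.subtype ∘ₗ s ∘ₗ f ∘ₗ N.mkQ ∘ₗ p
      have hpv (v : R) : p v = v := DFunLike.congr_fun hp v
      have hsv (w : R ⧸ N) : N.mkQ (s w) = w := DFunLike.congr_fun hs w
      have hνX : ν * X = 0 := LinearMap.ext fun v => (s (f (N.mkQ (p v)))).2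
      have hXν : X * ν = 0 := LinearMap.ext fun v => by
        have hm : ν v ∈ R := DFunLike.congr_fun hνν v
        have h1 : N.mkQ (p (ν v)) = 0 := by
          rw [hpv ⟨ν v, hm⟩]
          exact (Submodule.Quotient.mk_eq_zero N).2 ⟨v, rfl⟩
        simp [X, h1]
      have hXγ : X * γ = γ * X := by
        have h1 : X * γ + X = 0 := by simpa [ν, mul_add] using hXν
        have h2 : γ * X + X = 0 := by simpa [ν, add_mul] using hνX
        exact add_right_cancel (h1.trans h2.symm)
      obtain ⟨z, hz⟩ := θ.surjective X
      have hzs : Algebra.TensorProduct.comm F A A z = z := by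
        refine θ.injective ?_
        have h1 := hγ z
        rw [hz, ← hXγ] at h1
        have h2 := congrArg (· * γ) h1
        simp only [mul_assoc, hγ2, mul_one] at h2
        rw [h2, hz]
      obtain ⟨c, y, hzy⟩ := exists_symmetric_tensor_eq b z hzs
      refine ⟨c, hext _ _ fun v => ?_⟩
      have hXv : N.mkQ (s (f (N.mkQ v))) = f (N.mkQ v) := hsv _
      rw [← hXv]
      simp only [Φ, Fintype.linearCombination_apply, LinearMap.sum_apply, LinearMap.smul_apply,
        hρ, hr, ← map_smul, ← map_sum]
      symm
      refine hmk _ _ (θ y v) ?_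
      have h1 : X v = s (f (N.mkQ v)) := by simp only [X, LinearMap.comp_apply, hpv]; rfl
      rw [← h1, ← hz, ← hnorm _ _ v.2, hzy]
      simp only [map_add, map_sum, map_smul, LinearMap.add_apply, LinearMap.sum_apply,
        LinearMap.smul_apply, Submodule.coe_sum, Submodule.coe_smul]
      rfl
    have := LinearMap.finrank_le_finrank_of_surjective hΦ
    rwa [Module.finrank_linearMap, Module.finrank_fin_fun, ← pow_two] at this

end FrobeniusRepresentations

section ExponentOneSplitting

variable {F A : Type} [Field F] [CharP F 2] [Ring A] [Algebra F A] [Algebra.IsCentral F A]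
  [IsSimpleRing A] [FiniteDimensional F A]

/-- A representation of the Frobenius twist of `A` of dimension at most the degree of `A`
becomes a splitting of `A` over a finite extension of exponent one. -/
theorem exists_splitting_of_frobenius_representation {W : Type} [AddCommGroup W] [Module F W]
    [FiniteDimensional F W] [Nontrivial W] (ρ : A →+* Module.End F W)
    (hρ : ∀ (c : F) (a : A), ρ (c • a) = c ^ 2 • ρ a)
    (hle : Module.finrank F W ^ 2 ≤ Module.finrank F A) :
    ∃ r, HasExponentOneSplitting F A r := by
  let Ω := AlgebraicClosure F
  have : CharP Ω 2 := charP_of_injective_algebraMap (algebraMap F Ω).injective 2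
  let s : F →+* Ω := ((frobeniusEquiv Ω 2).symm : Ω →+* Ω).comp (algebraMap F Ω)
  have hs (c : F) : s c ^ 2 = algebraMap F Ω c := frobenius_apply_frobeniusEquiv_symm Ω 2 _
  have hs' (c : F) : s (c ^ 2) = algebraMap F Ω c := by rw [map_pow, hs]
  let g := Module.finrank F W
  have : NeZero g := ⟨Module.finrank_pos.ne'⟩
  let M : A →+* Matrix (Fin g) (Fin g) Ω := (s.mapMatrix).comp
    (((LinearMap.toMatrixAlgEquiv (Module.finBasis F W)) : _ →+* Matrix (Fin g) (Fin g) F).comp ρ)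
  have hM2 (a : A) (i j) : M a i j ^ 2 ∈ (algebraMap F Ω).range := ⟨_, (hs _).symm⟩
  have hMs (c : F) (a : A) (i j) : M (c • a) i j = algebraMap F Ω c * M a i j := by
    simp [M, hρ, ← hs']
  let b := Module.finBasis F A
  let S : Set Ω := Set.range fun x : Fin (Module.finrank F A) × Fin g × Fin g =>
    M (b x.1) x.2.1 x.2.2
  let K := IntermediateField.adjoin F S
  have hK : ∀ z ∈ K, z ^ 2 ∈ (algebraMap F Ω).range := fun z hz => by
    induction hz using IntermediateField.adjoin_induction with
    | mem y hy => obtain ⟨x, rfl⟩ := hy; exact hM2 _ _ _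
    | algebraMap r => exact ⟨r ^ 2, map_pow _ _ _⟩
    | add y z _ _ hy hz => rw [CharTwo.add_sq]; exact add_mem hy hz
    | mul y z _ _ hy hz => rw [mul_pow]; exact mul_mem hy hz
    | inv y _ hy =>
      obtain ⟨r, hr⟩ := hy
      exact ⟨r⁻¹, by rw [map_inv₀, hr, inv_pow]⟩
  have hMK (a : A) (i j) : M a i j ∈ K := by
    rw [← b.sum_repr a, map_sum, Matrix.sum_apply]
    refine sum_mem fun k _ => ?_
    rw [hMs]
    exact mul_mem (K.algebraMap_mem _)
      (IntermediateField.subset_adjoin F S ⟨(k, i, j), rfl⟩)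
  let ψ : A →ₐ[F] Matrix (Fin g) (Fin g) K :=
    { toFun a := Matrix.of fun i j => ⟨M a i j, hMK a i j⟩
      map_one' := by
        ext i j
        simp [Matrix.one_apply, apply_ite]
      map_mul' x y := by ext i j; simp [Matrix.mul_apply]
      map_zero' := by ext i j; simp
      map_add' x y := by ext i j; simp
      commutes' c := by
        ext i j
        simp [Algebra.algebraMap_eq_smul_one, hMs, Matrix.one_apply, apply_ite]
        split_ifs <;> simp_all }
  let φ : A →ₐ[F] Module.End K (Fin g → K) :=
    (Matrix.toLinAlgEquiv'.toAlgHom.restrictScalars F).comp ψ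
  have : Finite S := Set.finite_range _
  have hfin : FiniteDimensional F K :=
    IntermediateField.finiteDimensional_adjoin fun x _ => Algebra.IsIntegral.isIntegral x
  have hcard : Module.finrank K (Fin g → K) = g := Module.finrank_fin_fun K
  refine ⟨_, K, inferInstance, inferInstance, Fin g → K, inferInstance, inferInstance,
    inferInstance, inferInstance, φ, hfin, inferInstance, fun z => ?_, ?_, rfl⟩
  · obtain ⟨r, hr⟩ := hK z z.2
    exact ⟨r, Subtype.ext hr⟩
  · exact le_antisymm (finrank_le_sq_of_algHom φ) (by rwa [hcard])

theorem exists_splitting_of_tensor_square {V : Type} [AddCommGroup V] [Module F V]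
    [FiniteDimensional F V] (θ : A ⊗[F] A ≃ₐ[F] Module.End F V) :
    ∃ r, HasExponentOneSplitting F A r := by
  obtain ⟨W, _, _, ρ, _, _, hρ, hle⟩ := exists_frobenius_representation θ
  exact exists_splitting_of_frobenius_representation ρ hρ hle

end ExponentOneSplitting

/-- Over a field `F` of characteristic `2`, a central simple algebra of
exponent `2` and index `2 ^ n` is Brauer equivalent to a tensor product of at most
`2 ^ n - 1` quaternion algebras, i.e. `λ₂(A) ≤ 2 ^ n - 1`. -/
theorem statement10 (F : Type) [Field F] [CharP F 2]
    (A : Type) [Ring A] [Algebra F A] (hA : IsCSA F A) (hexp : HasExponent F A 2)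
    (n : ℕ) (hn : 0 < n) (hind : HasIndex F A (2 ^ n)) :
    SymbolLengthLE 2 F A (2 ^ n - 1) := by
  obtain ⟨_, _, _⟩ := hA
  obtain ⟨-, ⟨N, -, ⟨e⟩⟩, -⟩ := hexp
  obtain ⟨e₂⟩ := nonempty_piTensorProduct_succ_algEquiv (F := F) fun _ : Fin 2 => A
  obtain ⟨e₁⟩ := nonempty_piTensorProduct_succ_algEquiv (F := F) fun _ : Fin 1 => A
  obtain ⟨e₀⟩ := nonempty_piTensorProduct_zero_algEquiv (F := F) fun _ : Fin 0 => A
  let ι : A ≃ₐ[F] ⨂[F] _ : Fin 1, A :=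
    ((Algebra.TensorProduct.rid F F A).symm.trans
      (Algebra.TensorProduct.congr AlgEquiv.refl e₀)).trans e₁
  obtain ⟨D, _, _, m, hm, ⟨ε⟩, hd⟩ := hind
  have : NeZero m := ⟨hm.ne'⟩
  obtain ⟨r, hr, hsplit⟩ := exists_bounded_splitting ε hd <| exists_splitting_of_tensor_square <|
    ((Algebra.TensorProduct.congr AlgEquiv.refl ι).trans e₂).trans
      (e.trans Matrix.toLinAlgEquiv')
  obtain ⟨k, hk, a, b, hb, hequiv⟩ :=
    exists_quaternion_decomposition (2 ^ n - 1) A ⟨r, hr, hsplit⟩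
  exact ⟨k, hk, fun i => ℍ[F,a i,1,b i], _, _,
    fun i => isCyclicPAlg_quaternionAlgebra (hb i), hequiv⟩
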